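/- arXiv:1402.1726 — 6 statements merged into one kernel-verified Lean document; each statement's English description precedes it below -/
import Mathlib

section
/- One-layer expanding property (Lemma B.1): There exist constants C, c > 0 such that for every ε ∈ (0, 1/4), every k ≥ 1, every α ≥ 1 and every N ≥ C·αk, if B ≥ C·αk/ε and d ≥ C·(1/ε)·log(N/k), then a random (N,B,d) one-layer hashing scheme induces an (N, Bd, d, αk, ε)-bipartite expander with probability at least 1 − N^{−c}. -/
open Classical in
noncomputable def nbrSet {L R D : Type*} [Fintype D] (nbr : L → D → R) (S : Finset L) :
    Finset R :=
  S.biUnion (fun i => Finset.image (nbr i) Finset.univ)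

/-- The `(ℓ, ε)`-bipartite-expander property for the `|D|`-left-regular bipartite graph
whose left vertex `i` has neighbours `nbr i j`, `j : D`. -/
def IsExpander {L R D : Type*} [Fintype D] (ℓ ε : ℝ) (nbr : L → D → R) : Prop :=
  ∀ S : Finset L, (S.card : ℝ) ≤ ℓ →
    (1 - ε) * (Fintype.card D) * S.card ≤ ((nbrSet nbr S).card : ℝ)

/-- The `d`-left-regular bipartite graph (with `B·d` right nodes indexed by `[B]×[d]`)
induced by an instance `f` of the `(N,B,d)` one-layer hashing scheme. -/
def oneLayerNbr {N B d : ℕ} (f : Fin N → Fin d → Fin B) :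
    Fin N → Fin d → Fin B × Fin d :=
  fun i j => (f i j, j)

/-- Resampling one coordinate. -/
lemma sum_update_resample {I β : Type*} [Fintype I] [DecidableEq I] [Fintype β]
    (p : I) (H : (I → β) → ℝ) :
    ∑ f : I → β, ∑ b : β, H (Function.update f p b) = (Fintype.card β : ℝ) * ∑ f, H f := by
  classical
  have h1 : ∑ f : I → β, ∑ b : β, H (Function.update f p b)
      = ∑ x : (I → β) × β, H (Function.update x.1 p x.2) := by
    rw [Fintype.sum_prod_type]
  have h2 : ∑ x : (I → β) × β, H (Function.update x.1 p x.2) = ∑ x : (I → β) × β, H x.1 := by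
    refine Finset.sum_nbij' (fun x => (Function.update x.1 p x.2, x.1 p))
      (fun x => (Function.update x.1 p x.2, x.1 p)) ?_ ?_ ?_ ?_ ?_ <;> simp
  rw [h1, h2, Fintype.sum_prod_type]
  simp [Finset.mul_sum]

/-- Moment generating function of the number of collisions. -/
lemma mgf_collision {I D β : Type*} [Fintype I] [DecidableEq I] [Fintype β] [DecidableEq β]
    [DecidableEq D] (col : I → D) (y : ℝ) (hy : 1 ≤ y) (s : ℕ) (hβ : 0 < Fintype.card β)
    (P : Finset I) (hP : ∀ j, (P.filter (fun q => col q = j)).card ≤ s) :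
    ∑ f : I → β, y ^ (P.card - (P.image (fun q => (f q, col q))).card)
      ≤ (1 + y * s / Fintype.card β) ^ P.card * (Fintype.card (I → β) : ℝ) := by
  induction P using Finset.induction_on with
  | empty => simp
  | insert p P hp ih =>
    have hPs : ∀ j, (P.filter (fun q => col q = j)).card ≤ s := fun j =>
      (Finset.card_le_card (Finset.filter_subset_filter _ (Finset.subset_insert p P))).trans (hP j)
    have ih := ih hPs
    have hβ' : (0 : ℝ) < Fintype.card β := by exact_mod_cast hβ
    set G : (I → β) → ℝ := fun f => y ^ (P.card - (P.image (fun q => (f q, col q))).card) with hG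
    set A : (I → β) → Finset β := fun f => (P.filter (fun q => col q = col p)).image f with hA
    have hG0 : ∀ f, 0 ≤ G f := fun f => by simp only [hG]; positivity
    have hGu : ∀ f b, G (Function.update f p b) = G f := by
      intro f b
      simp only [hG]
      congr 3
      apply Finset.image_congr
      intro q hq
      have : q ≠ p := fun h => hp (h ▸ hq)
      simp [this]
    have hAu : ∀ f b, A (Function.update f p b) = A f := by
      intro f b
      simp only [hA]
      apply Finset.image_congr
      intro q hq
      have hq' : q ∈ P := (Finset.mem_filter.1 hq).1
      have : q ≠ p := fun h => hp (h ▸ hq')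
      simp [this]
    have hstep : ∀ f : I → β,
        y ^ ((insert p P).card - ((insert p P).image (fun q => (f q, col q))).card)
          ≤ G f + y * (if f p ∈ A f then G f else 0) := by
      intro f
      have hle : (P.image (fun q => (f q, col q))).card ≤ P.card := Finset.card_image_le
      rw [Finset.card_insert_of_notMem hp, Finset.image_insert]
      by_cases hmem : (f p, col p) ∈ P.image (fun q => (f q, col q))
      · have : f p ∈ A f := by
          simp only [hA, Finset.mem_image, Finset.mem_filter, Prod.mk.injEq] at hmem ⊢
          obtain ⟨q, hq, h1, h2⟩ := hmem
          exact ⟨q, ⟨hq, h2⟩, h1⟩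
        rw [Finset.insert_eq_of_mem hmem, if_pos this, Nat.sub_add_comm hle, pow_succ]
        have := hG0 f
        simp only [hG] at this ⊢
        linarith
      · rw [Finset.card_insert_of_notMem hmem, Nat.add_sub_add_right]
        have h0 : 0 ≤ y * (if f p ∈ A f then G f else 0) := by
          apply mul_nonneg (by linarith)
          split_ifs
          · exact hG0 f
          · exact le_rfl
        simp only [hG] at h0 ⊢
        linarith
    have hkey : (Fintype.card β : ℝ) * ∑ f : I → β, (if f p ∈ A f then G f else 0)
        ≤ s * ∑ f, G f := by
      rw [← sum_update_resample p, Finset.mul_sum]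
      apply Finset.sum_le_sum
      intro f _
      simp only [hGu, hAu, Function.update_self]
      rw [← Finset.sum_filter, Finset.sum_const, nsmul_eq_mul]
      apply mul_le_mul_of_nonneg_right _ (hG0 f)
      have : (A f).card ≤ s := Finset.card_image_le.trans (hPs _)
      simpa using this
    have hkey2 : ∑ f : I → β, (if f p ∈ A f then G f else 0)
        ≤ s / Fintype.card β * ∑ f, G f := by
      rw [div_mul_eq_mul_div, le_div_iff₀ hβ']
      linarith
    calc _ ≤ ∑ f : I → β, (G f + y * (if f p ∈ A f then G f else 0)) :=
          Finset.sum_le_sum (fun f _ => hstep f)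
      _ = ∑ f, G f + y * ∑ f : I → β, (if f p ∈ A f then G f else 0) := by
          rw [Finset.sum_add_distrib, Finset.mul_sum]
      _ ≤ ∑ f, G f + y * (s / Fintype.card β * ∑ f, G f) := by gcongr
      _ = (1 + y * s / Fintype.card β) * ∑ f, G f := by ring
      _ ≤ (1 + y * s / Fintype.card β) *
          ((1 + y * s / Fintype.card β) ^ P.card * (Fintype.card (I → β) : ℝ)) := by
          gcongr
      _ = _ := by rw [Finset.card_insert_of_notMem hp]; ring

open Classical in
/-- The same for the one-layer scheme. -/
lemma mgf_oneLayer {N B d : ℕ} (hB : 0 < B) (S : Finset (Fin N)) (y : ℝ) (hy : 1 ≤ y) :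
    ∑ f : Fin N → Fin d → Fin B, y ^ (S.card * d - (nbrSet (oneLayerNbr f) S).card)
      ≤ (1 + y * S.card / B) ^ (S.card * d) * (Fintype.card (Fin N → Fin d → Fin B) : ℝ) := by
  have h := mgf_collision (I := Fin N × Fin d) (β := Fin B) Prod.snd y hy S.card (by simpa using hB)
    (S ×ˢ Finset.univ) (by
      intro j
      apply Finset.card_le_card_of_injOn Prod.fst
      · intro q hq
        simp at hq
        exact hq.1
      · rintro ⟨a, b⟩ hq ⟨a', b'⟩ hq' h
        simp at hq hq' h ⊢
        exact ⟨h, hq.2.trans hq'.2.symm⟩)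
  rw [← (Equiv.curry (Fin N) (Fin d) (Fin B)).sum_comp,
    ← Fintype.card_congr (Equiv.curry (Fin N) (Fin d) (Fin B))]
  rw [Finset.card_product, Finset.card_univ, Fintype.card_fin, Fintype.card_fin] at h
  convert h using 5 with f
  ext ⟨b, j⟩
  simp only [nbrSet, oneLayerNbr, Finset.mem_biUnion, Finset.mem_image, Finset.mem_product,
    Finset.mem_univ, true_and, and_true, Prod.exists, Equiv.curry_apply, Function.curry]
  constructor
  · rintro ⟨a, ha, c, h⟩
    exact ⟨a, c, ha, h⟩
  · rintro ⟨a, c, ha, h⟩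
    exact ⟨a, ha, c, h⟩

lemma card_nbr_le_gen {L R D : Type*} [Fintype D] (nbr : L → D → R) (S : Finset L) :
    (nbrSet nbr S).card ≤ S.card * Fintype.card D := by
  classical
  unfold nbrSet
  refine Finset.card_biUnion_le_card_mul _ _ _ (fun i _ => ?_)
  exact Finset.card_image_le

lemma card_nbr_le {N B d : ℕ} (f : Fin N → Fin d → Fin B) (S : Finset (Fin N)) :
    (nbrSet (oneLayerNbr f) S).card ≤ S.card * d := by
  simpa using card_nbr_le_gen (oneLayerNbr f) S

/-- The set of instances violating expansion at `S`. -/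
noncomputable def badSet (N B d : ℕ) (ε : ℝ) (S : Finset (Fin N)) :
    Finset (Fin N → Fin d → Fin B) :=
  haveI := Classical.decPred (fun f : Fin N → Fin d → Fin B =>
    ((nbrSet (oneLayerNbr f) S).card : ℝ) < (1 - ε) * d * S.card)
  Finset.univ.filter (fun f : Fin N → Fin d → Fin B =>
    ((nbrSet (oneLayerNbr f) S).card : ℝ) < (1 - ε) * d * S.card)

lemma bad_le {N B d : ℕ} (hB : 0 < B) (S : Finset (Fin N)) (hS : 0 < S.card) (ε : ℝ)
    (hε : 0 < ε) (hy : (S.card : ℝ) ≤ ε * B) :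
    ((badSet N B d ε S).card : ℝ) ≤
      Real.exp (- (ε * d * S.card * (Real.log (ε * B / S.card) - 1)))
        * (Fintype.card (Fin N → Fin d → Fin B) : ℝ) := by
  have hs : (0 : ℝ) < S.card := by exact_mod_cast hS
  have hB' : (0 : ℝ) < B := by exact_mod_cast hB
  set y : ℝ := ε * B / S.card with hydef
  have hy1 : 1 ≤ y := by rw [hydef, le_div_iff₀ hs]; linarith
  have hy0 : 0 < y := by linarith
  have hm := mgf_oneLayer (d := d) hB S y hy1
  have h1 : ((badSet N B d ε S).card : ℝ) * Real.exp (ε * d * S.card * Real.log y) ≤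
      ∑ f : Fin N → Fin d → Fin B, y ^ (S.card * d - (nbrSet (oneLayerNbr f) S).card) := by
    rw [← nsmul_eq_mul, ← Finset.sum_const]
    refine le_trans (Finset.sum_le_sum (s := badSet N B d ε S)
      (g := fun f => y ^ (S.card * d - (nbrSet (oneLayerNbr f) S).card)) ?_) ?_
    · intro f hf
      have hf' : ((nbrSet (oneLayerNbr f) S).card : ℝ) < (1 - ε) * d * S.card := by
        simpa [badSet] using hf
      rw [← Real.rpow_natCast, Real.rpow_def_of_pos hy0, Nat.cast_sub (card_nbr_le f S)]
      apply Real.exp_le_exp.2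
      rw [mul_comm]
      apply mul_le_mul_of_nonneg_left _ (Real.log_nonneg hy1)
      push_cast
      nlinarith
    · apply Finset.sum_le_univ_sum_of_nonneg
      intro f
      positivity
  have h2 : (1 + y * S.card / B) ^ (S.card * d) ≤ Real.exp (ε * d * S.card) := by
    have : y * S.card / B = ε := by rw [hydef]; field_simp
    rw [this]
    calc (1 + ε) ^ (S.card * d) ≤ (Real.exp ε) ^ (S.card * d) := by
          gcongr
          linarith [Real.add_one_le_exp ε]
      _ = _ := by
          rw [← Real.exp_nat_mul]
          congr 1
          push_cast
          ring
  have h3 : ((badSet N B d ε S).card : ℝ) * Real.exp (ε * d * S.card * Real.log y) ≤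
      Real.exp (ε * d * S.card) * (Fintype.card (Fin N → Fin d → Fin B) : ℝ) :=
    h1.trans (hm.trans (by gcongr))
  have h4 : - (ε * d * S.card * (Real.log y - 1)) =
      ε * d * S.card - ε * d * S.card * Real.log y := by ring
  rw [h4, Real.exp_sub, div_mul_eq_mul_div, le_div_iff₀ (Real.exp_pos _)]
  exact h3

lemma choose_le_exp (N s : ℕ) (hs : 0 < s) (hN : 0 < N) :
    (N.choose s : ℝ) ≤ Real.exp (s * (1 + Real.log (N / s))) := by
  have hs' : (0 : ℝ) < s := by exact_mod_cast hs
  have hN' : (0 : ℝ) < N := by exact_mod_cast hN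
  have h1 : (N.choose s : ℝ) ≤ (N : ℝ) ^ s / s.factorial := Nat.choose_le_pow_div s N
  have h2 := Real.pow_div_factorial_le_exp (s : ℝ) hs'.le s
  have h3 : Real.exp (s * (1 + Real.log (N / s))) = Real.exp s * ((N : ℝ) / s) ^ s := by
    rw [mul_add, Real.exp_add, mul_one, Real.exp_nat_mul, Real.exp_log (by positivity)]
  rw [h3]
  calc _ ≤ _ := h1
    _ = ((s : ℝ) ^ s / s.factorial) * ((N : ℝ) / s) ^ s := by
      rw [div_pow]; field_simp
    _ ≤ _ := by gcongr

lemma log_key (N s : ℕ) (hs : 0 < s) (h : Real.exp 1 * s ≤ N) :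
    Real.log N ≤ s * Real.log (N / s) := by
  have hs' : (1 : ℝ) ≤ s := by exact_mod_cast hs
  have hN' : (0 : ℝ) < N := lt_of_lt_of_le (by positivity) h
  have h1 : 1 ≤ Real.log (N / s) := by
    rw [Real.le_log_iff_exp_le (by positivity), le_div_iff₀ (by positivity)]
    exact h
  have h2 : Real.log N = Real.log (N / s) + Real.log s := by
    rw [Real.log_div (by positivity) (by positivity)]; ring
  have h3 := Real.log_le_sub_one_of_pos (by positivity : (0 : ℝ) < s)
  nlinarith

/-- Union bound for sets of a fixed size. -/
lemma level_bound (ε : ℝ) (hε : 0 < ε) (k : ℕ) (hk : 1 ≤ k) (α : ℝ) (hα : 1 ≤ α)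
    (N B d s : ℕ) (hN : (N : ℝ) ≥ Real.exp 3 * α * k)
    (hB : (B : ℝ) ≥ Real.exp 3 * α * k / ε)
    (hd : (d : ℝ) ≥ Real.exp 3 * (1/ε) * Real.log ((N : ℝ) / k))
    (hs : 0 < s) (hsK : (s : ℝ) ≤ α * k) :
    ∑ S ∈ (Finset.univ : Finset (Fin N)).powersetCard s, ((badSet N B d ε S).card : ℝ)
      ≤ (1 / (N : ℝ) ^ 2) * (Fintype.card (Fin N → Fin d → Fin B) : ℝ) := by
  have hk' : (1 : ℝ) ≤ k := by exact_mod_cast hk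
  have hs' : (1 : ℝ) ≤ s := by exact_mod_cast hs
  have hC : (4 : ℝ) ≤ Real.exp 3 := by linarith [Real.add_one_le_exp (3 : ℝ)]
  have hK : 0 < α * k := by positivity
  have hN0 : (0 : ℝ) < N := lt_of_lt_of_le (by positivity) hN
  have hεB : Real.exp 3 * (α * k) ≤ ε * B := by
    have := (div_le_iff₀ hε).1 hB
    linarith
  have hB0 : 0 < B := by
    rcases Nat.eq_zero_or_pos B with h | h
    · subst h
      simp at hεB
      nlinarith
    · exact h
  have hB0' : (0 : ℝ) < B := by exact_mod_cast hB0
  set L := Real.log ((N : ℝ) / k) with hL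
  have hL3 : 3 ≤ L := by
    rw [hL, Real.le_log_iff_exp_le (by positivity), le_div_iff₀ (by positivity)]
    nlinarith [mul_le_mul_of_nonneg_left hα (by positivity : 0 ≤ Real.exp 3 * (k : ℝ))]
  have hεd : 4 * L ≤ ε * d := by
    have h1 : ε * (Real.exp 3 * (1/ε) * L) ≤ ε * d := mul_le_mul_of_nonneg_left hd hε.le
    have h2 : ε * (Real.exp 3 * (1/ε) * L) = Real.exp 3 * L := by field_simp
    nlinarith
  set x := Real.log (α * k / s) with hx
  have hx0 : 0 ≤ x := Real.log_nonneg (by rw [le_div_iff₀ (by positivity)]; linarith)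
  have hlogy : 3 + x ≤ Real.log (ε * B / s) := by
    rw [Real.le_log_iff_exp_le (by positivity), Real.exp_add, hx, Real.exp_log (by positivity),
      ← mul_div_assoc]
    gcongr
  have hlogNs : Real.log ((N : ℝ) / s) ≤ L + x := by
    rw [hL, hx, ← Real.log_mul (by positivity) (by positivity)]
    apply Real.log_le_log (by positivity)
    have : (N : ℝ) / k * (α * k / s) = α * (N / s) := by field_simp
    rw [this]
    have : 0 < (N : ℝ) / s := by positivity
    nlinarith
  have hes : Real.exp 1 * s ≤ N := by
    have : Real.exp 1 ≤ Real.exp 3 := Real.exp_le_exp.2 (by norm_num)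
    calc Real.exp 1 * s ≤ Real.exp 3 * (α * k) := by gcongr
      _ ≤ N := by linarith
  have hkey := log_key N s hs hes
  set l := Real.log ((N : ℝ) / s) with hl
  have hsy : (s : ℝ) ≤ ε * B := by nlinarith
  have hexp : s * (1 + l) + -(ε * d * s * (Real.log (ε * B / s) - 1)) ≤ - (2 * Real.log N) := by
    have h1 : 4 * L * (2 + x) ≤ ε * d * (Real.log (ε * B / s) - 1) := by
      apply mul_le_mul hεd (by linarith) (by linarith) (by positivity)
    have h2 : 1 + 3 * l ≤ 4 * L * (2 + x) := by nlinarith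
    have h3 : (s : ℝ) * (1 + 3 * l) ≤ s * (ε * d * (Real.log (ε * B / s) - 1)) := by
      apply mul_le_mul_of_nonneg_left (h2.trans h1) (by linarith)
    nlinarith
  have hchoose := choose_le_exp N s hs (by exact_mod_cast hN0)
  calc _ ≤ ∑ S ∈ (Finset.univ : Finset (Fin N)).powersetCard s,
        Real.exp (- (ε * d * s * (Real.log (ε * B / s) - 1)))
        * (Fintype.card (Fin N → Fin d → Fin B) : ℝ) := by
        apply Finset.sum_le_sum
        intro S hS
        have hc : S.card = s := (Finset.mem_powersetCard.1 hS).2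
        have := bad_le (d := d) hB0 S (by omega) ε hε (by rw [hc]; exact hsy)
        rw [hc] at this
        exact this
    _ = (N.choose s : ℝ) * Real.exp (- (ε * d * s * (Real.log (ε * B / s) - 1)))
        * (Fintype.card (Fin N → Fin d → Fin B) : ℝ) := by
        rw [Finset.sum_const, Finset.card_powersetCard, Finset.card_univ, Fintype.card_fin,
          nsmul_eq_mul]
        ring
    _ ≤ Real.exp (s * (1 + l)) * Real.exp (- (ε * d * s * (Real.log (ε * B / s) - 1)))
        * (Fintype.card (Fin N → Fin d → Fin B) : ℝ) := by gcongr
    _ ≤ _ := by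
        rw [← Real.exp_add]
        gcongr
        refine (Real.exp_le_exp.2 hexp).trans (le_of_eq ?_)
        rw [Real.exp_neg, one_div, two_mul, Real.exp_add, Real.exp_log hN0, sq]

open Classical in
/-- One-layer expanding property (Lemma B.1), stated by counting instances of the
one-layer hashing scheme. -/
theorem one_layer_expanding :
    ∃ C c : ℝ, 0 < C ∧ 0 < c ∧
      ∀ ε : ℝ, 0 < ε → ε < 1/4 →
      ∀ k : ℕ, 1 ≤ k →
      ∀ α : ℝ, 1 ≤ α →
      ∀ N : ℕ, (N : ℝ) ≥ C * α * k →
      ∀ B d : ℕ,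
        (B : ℝ) ≥ C * α * k / ε →
        (d : ℝ) ≥ C * (1/ε) * Real.log ((N : ℝ) / k) →
        ((Finset.univ.filter (fun f : Fin N → Fin d → Fin B =>
            IsExpander (α * k) ε (oneLayerNbr f))).card : ℝ)
          ≥ (1 - (N : ℝ) ^ (-c)) * (Fintype.card (Fin N → Fin d → Fin B)) := by
  refine ⟨Real.exp 3, 1, Real.exp_pos _, one_pos, ?_⟩
  intro ε hε _ k hk α hα N hN B d hB hd
  have hk' : (1 : ℝ) ≤ k := by exact_mod_cast hk
  have hN0 : (0 : ℝ) < N := lt_of_lt_of_le (by positivity) hN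
  set T := (Fintype.card (Fin N → Fin d → Fin B) : ℝ) with hT
  set I : Finset ℕ := (Finset.Icc 1 N).filter (fun s => (s : ℝ) ≤ α * k) with hI
  have hsub : Finset.univ.filter (fun f : Fin N → Fin d → Fin B =>
      ¬ IsExpander (α * k) ε (oneLayerNbr f)) ⊆
      I.biUnion (fun s => ((Finset.univ : Finset (Fin N)).powersetCard s).biUnion
        (fun S => badSet N B d ε S)) := by
    intro f hf
    simp only [Finset.mem_filter, Finset.mem_univ, true_and, IsExpander, not_forall, not_le,
      Fintype.card_fin] at hf
    obtain ⟨S, hS, hlt⟩ := hf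
    have hS0 : 0 < S.card := by
      rcases Nat.eq_zero_or_pos S.card with h | h
      · rw [h] at hlt
        simp at hlt
        exact absurd hlt (not_lt.2 (Nat.cast_nonneg _))
      · exact h
    have hSN : S.card ≤ N := by simpa using Finset.card_le_univ S
    simp only [Finset.mem_biUnion, hI, Finset.mem_filter, Finset.mem_Icc,
      Finset.mem_powersetCard, Finset.subset_univ, true_and]
    exact ⟨S.card, ⟨⟨hS0, hSN⟩, hS⟩, S, rfl, by simpa [badSet] using hlt⟩
  have hbad : ((Finset.univ.filter (fun f : Fin N → Fin d → Fin B =>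
      ¬ IsExpander (α * k) ε (oneLayerNbr f))).card : ℝ) ≤ (N : ℝ)⁻¹ * T := by
    have h1 := (Finset.card_le_card hsub).trans (Finset.card_biUnion_le.trans
      (Finset.sum_le_sum (fun s _ => Finset.card_biUnion_le)))
    have h2 : ((Finset.univ.filter (fun f : Fin N → Fin d → Fin B =>
      ¬ IsExpander (α * k) ε (oneLayerNbr f))).card : ℝ) ≤ ∑ s ∈ I,
        ∑ S ∈ (Finset.univ : Finset (Fin N)).powersetCard s, ((badSet N B d ε S).card : ℝ) := by
      exact_mod_cast h1
    have hIc : (I.card : ℝ) ≤ N := by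
      have : I.card ≤ (Finset.Icc 1 N).card := Finset.card_filter_le _ _
      simp at this
      exact_mod_cast this
    calc _ ≤ _ := h2
      _ ≤ ∑ s ∈ I, (1 / (N : ℝ) ^ 2) * T := by
        apply Finset.sum_le_sum
        intro s hs
        simp only [hI, Finset.mem_filter, Finset.mem_Icc] at hs
        exact level_bound ε hε k hk α hα N B d s hN hB hd hs.1.1 hs.2
      _ = I.card * ((1 / (N : ℝ) ^ 2) * T) := by rw [Finset.sum_const, nsmul_eq_mul]
      _ ≤ N * ((1 / (N : ℝ) ^ 2) * T) := by gcongr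
      _ = _ := by field_simp
  have htot := Finset.card_filter_add_card_filter_not
    (s := (Finset.univ : Finset (Fin N → Fin d → Fin B)))
    (fun f : Fin N → Fin d → Fin B => IsExpander (α * k) ε (oneLayerNbr f))
  have htot' : ((Finset.univ.filter (fun f : Fin N → Fin d → Fin B =>
      IsExpander (α * k) ε (oneLayerNbr f))).card : ℝ) + ((Finset.univ.filter
      (fun f : Fin N → Fin d → Fin B => ¬ IsExpander (α * k) ε (oneLayerNbr f))).card : ℝ) = T := by
    rw [hT, ← Finset.card_univ]
    exact_mod_cast htot
  rw [Real.rpow_neg_one]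
  linarith
end

section
/- One-layer isolation property (Lemma B.2): For every constant A ≥ 1 there exist constants C, c > 0 such that for every ε, ζ ∈ (0, 1/4), every k ≥ 1 and every N ≥ C·k/ε, if B ≥ C·k/(ζε) and d ≥ C·(1/(ζε))·log(N/k), then with probability at least 1 − N^{−c} the bipartite graph induced by a random (N,B,d) one-layer hashing scheme satisfies the (⌈A·k/ε⌉, ε, ζ)-isolation property. -/
open Classical in
/-- `U_S({x})`: right nodes adjacent to `x` but to no other element of `S`. -/
noncomputable def isolNbrs {L R D : Type*} [Fintype D] (nbr : L → D → R) (S : Finset L)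
    (x : L) : Finset R :=
  (Finset.image (nbr x) Finset.univ).filter (fun u => ∀ z ∈ S, z ≠ x → ∀ j, nbr z j ≠ u)

/-- The `(L₀, η, ζ)`-isolation property for the `|D|`-left-regular bipartite graph
whose left vertex `i` has neighbours `nbr i j`, `j : D`. -/
def HasIsolation {L R D : Type*} [Fintype D] (L₀ : ℕ) (η ζ : ℝ) (nbr : L → D → R) : Prop :=
  ∀ S : Finset L, S.card ≤ L₀ →
    ∃ S' ⊆ S, (1 - η) * S.card ≤ (S'.card : ℝ) ∧
      ∀ x ∈ S', (1 - ζ) * (Fintype.card D) ≤ ((isolNbrs nbr S x).card : ℝ)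

/-- rank: elements outside `T` come first. -/
def rkOf {N : ℕ} (T : Finset (Fin N)) (x : Fin N) : ℕ := x.val + if x ∈ T then N else 0

lemma rkOf_inj {N : ℕ} (T : Finset (Fin N)) {x y : Fin N} (h : rkOf T x = rkOf T y) : x = y := by
  unfold rkOf at h
  have hx := x.isLt
  have hy := y.isLt
  apply Fin.ext
  split_ifs at h <;> omega

lemma rkOf_mem {N : ℕ} (T : Finset (Fin N)) {x y : Fin N} (hx : x ∈ T)
    (h : rkOf T x < rkOf T y) : y ∈ T := by
  by_contra hy
  have := y.isLt
  simp only [rkOf, hx, hy, if_true, if_false] at h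
  omega

open Classical in
lemma count_fixed {N B d : ℕ} (T : Finset (Fin N)) (P : Finset (Fin N × Fin d))
    (g : P → Fin N) :
    (Finset.univ.filter (fun f : Fin N → Fin d → Fin B =>
      ∀ p : P, rkOf T (g p) < rkOf T p.1.1 ∧ f (g p) p.1.2 = f p.1.1 p.1.2)).card * B ^ P.card
      ≤ Fintype.card (Fin N → Fin d → Fin B) := by
  have h1 : (Finset.univ.filter (fun f : Fin N → Fin d → Fin B =>
      ∀ p : P, rkOf T (g p) < rkOf T p.1.1 ∧ f (g p) p.1.2 = f p.1.1 p.1.2)).card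
      ≤ Fintype.card ({p : Fin N × Fin d // p ∉ P} → Fin B) := by
    rw [← Finset.card_univ]
    refine Finset.card_le_card_of_injOn (fun f p => f p.1.1 p.1.2) (by intro f _; simp) ?_
    intro f hf f' hf' hff
    simp only [Finset.coe_filter, Finset.mem_univ, true_and, Set.mem_ofPred_eq] at hf hf'
    have key : ∀ n : ℕ, ∀ x : Fin N, rkOf T x = n → ∀ j, f x j = f' x j := by
      intro n
      induction n using Nat.strong_induction_on with
      | _ n ih =>
        intro x hx j
        by_cases hp : (x, j) ∈ P
        · obtain ⟨ha, hb⟩ := hf ⟨(x, j), hp⟩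
          obtain ⟨ha', hb'⟩ := hf' ⟨(x, j), hp⟩
          simp only at ha hb hb'
          rw [← hb, ← hb']
          exact ih _ (hx ▸ ha) _ rfl j
        · exact congrFun hff ⟨(x, j), hp⟩
    funext x j
    exact key _ x rfl j
  have h2 : Fintype.card (Fin N → Fin d → Fin B)
      = Fintype.card ({p : Fin N × Fin d // p ∉ P} → Fin B) * B ^ P.card := by
    have hc : Fintype.card {p : Fin N × Fin d // p ∉ P} + P.card = N * d := by
      rw [Fintype.card_subtype_compl]
      have := Finset.card_le_univ P
      simp at this ⊢
      omega
    simp only [Fintype.card_fun, Fintype.card_fin]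
    rw [← pow_add, hc, ← pow_mul, mul_comm]
  rw [h2]
  exact Nat.mul_le_mul_right _ h1

open Classical in
lemma count_constraint {N B d : ℕ} (S T : Finset (Fin N)) (P : Finset (Fin N × Fin d)) :
    (Finset.univ.filter (fun f : Fin N → Fin d → Fin B =>
      ∀ p ∈ P, ∃ z ∈ S, rkOf T z < rkOf T p.1 ∧ f z p.2 = f p.1 p.2)).card * B ^ P.card
      ≤ S.card ^ P.card * Fintype.card (Fin N → Fin d → Fin B) := by
  set E : (P → S) → Finset (Fin N → Fin d → Fin B) := fun g =>
    Finset.univ.filter (fun f : Fin N → Fin d → Fin B =>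
      ∀ p : P, rkOf T (g p).1 < rkOf T p.1.1 ∧ f (g p).1 p.1.2 = f p.1.1 p.1.2) with hE
  have hsub : (Finset.univ.filter (fun f : Fin N → Fin d → Fin B =>
      ∀ p ∈ P, ∃ z ∈ S, rkOf T z < rkOf T p.1 ∧ f z p.2 = f p.1 p.2))
      ⊆ Finset.univ.biUnion E := by
    intro f hf
    simp only [Finset.mem_filter, Finset.mem_univ, true_and] at hf
    choose g hg using hf
    simp only [Finset.mem_biUnion, Finset.mem_univ, true_and, hE, Finset.mem_filter]
    exact ⟨fun p => ⟨g p.1 p.2, (hg p.1 p.2).1⟩, fun p => (hg p.1 p.2).2⟩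
  calc _ ≤ (Finset.univ.biUnion E).card * B ^ P.card :=
        Nat.mul_le_mul_right _ (Finset.card_le_card hsub)
    _ ≤ (∑ g, (E g).card) * B ^ P.card := Nat.mul_le_mul_right _ Finset.card_biUnion_le
    _ = ∑ g, (E g).card * B ^ P.card := Finset.sum_mul _ _ _
    _ ≤ ∑ g : P → S, Fintype.card (Fin N → Fin d → Fin B) :=
        Finset.sum_le_sum fun g _ => count_fixed T P (fun p => (g p).1)
    _ = _ := by simp [Finset.sum_const, Finset.card_univ]

open Classical in
/-- pairs in `T × [d]` that collide with an earlier element. -/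
noncomputable def Dset {N B d : ℕ} (S T : Finset (Fin N)) (f : Fin N → Fin d → Fin B) :
    Finset (Fin N × Fin d) :=
  (T ×ˢ Finset.univ).filter (fun p => ∃ z ∈ S, rkOf T z < rkOf T p.1 ∧ f z p.2 = f p.1 p.2)

open Classical in
/-- pairs in `T × [d]` that collide with another element. -/
noncomputable def Cset {N B d : ℕ} (S T : Finset (Fin N)) (f : Fin N → Fin d → Fin B) :
    Finset (Fin N × Fin d) :=
  (T ×ˢ Finset.univ).filter (fun p => ∃ z ∈ S, z ≠ p.1 ∧ f z p.2 = f p.1 p.2)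

open Classical in
lemma halving {N B d : ℕ} (S T : Finset (Fin N)) (hTS : T ⊆ S) (f : Fin N → Fin d → Fin B) :
    (Cset S T f).card ≤ 2 * (Dset S T f).card := by
  have h : ((Cset S T f) \ (Dset S T f)).card ≤ (Dset S T f).card := by
    have hex : ∀ p ∈ Cset S T f \ Dset S T f, ∃ z ∈ T, rkOf T p.1 < rkOf T z ∧
        f z p.2 = f p.1 p.2 := by
      rintro ⟨x, j⟩ hp
      simp only [Cset, Dset, Finset.mem_sdiff, Finset.mem_filter, Finset.mem_product,
        Finset.mem_univ, and_true, not_and, not_exists] at hp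
      obtain ⟨⟨hxT, z, hz, hzx, hf⟩, hn⟩ := hp
      have hn' := hn hxT z hz
      have hlt : rkOf T x < rkOf T z := by
        by_contra hle
        rcases lt_or_eq_of_le (not_lt.mp hle) with h | h
        · exact hn' h hf
        · exact hzx (rkOf_inj T h)
      exact ⟨z, rkOf_mem T hxT hlt, hlt, hf⟩
    have hex' : ∀ p : Fin N × Fin d, ∃ z, p ∈ Cset S T f \ Dset S T f →
        (z ∈ T ∧ rkOf T p.1 < rkOf T z ∧ f z p.2 = f p.1 p.2) := by
      intro p
      by_cases hp : p ∈ Cset S T f \ Dset S T f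
      · obtain ⟨z, hz⟩ := hex p hp
        exact ⟨z, fun _ => hz⟩
      · exact ⟨p.1, fun h => absurd h hp⟩
    choose φ hφ using hex'
    refine Finset.card_le_card_of_injOn (fun p => (φ p, p.2)) ?_ ?_
    · rintro ⟨x, j⟩ hp
      obtain ⟨h1, h2, h3⟩ := hφ _ hp
      have hp' : (x, j) ∈ Cset S T f := (Finset.mem_sdiff.mp hp).1
      simp only [Cset, Finset.mem_filter, Finset.mem_product, Finset.mem_univ, and_true] at hp'
      simp only [Dset, Finset.coe_filter, Set.mem_ofPred_eq, Finset.mem_product, Finset.mem_univ,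
        and_true]
      exact ⟨h1, x, hTS hp'.1, h2, h3.symm⟩
    · rintro ⟨x, j⟩ hp ⟨x', j'⟩ hp' heq
      obtain ⟨h1, h2, h3⟩ := hφ _ hp
      obtain ⟨h1', h2', h3'⟩ := hφ _ hp'
      simp only [Prod.mk.injEq] at heq
      obtain ⟨e1, rfl⟩ := heq
      have hxx : f x j = f x' j := by
        simp only at h3 h3'
        rw [← h3, ← h3', e1]
      simp only [Cset, Dset, Finset.coe_sdiff, Set.mem_sdiff, Finset.mem_coe, Finset.mem_filter,
        Finset.mem_product, Finset.mem_univ, and_true, not_and, not_exists] at hp hp'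
      have hxT := hp.1.1
      have hxT' := hp'.1.1
      have a1 := hp.2 hxT x' (hTS hxT')
      have a2 := hp'.2 hxT' x (hTS hxT)
      have : rkOf T x = rkOf T x' := by
        apply le_antisymm
        · by_contra hh
          exact a1 (not_le.mp hh) hxx.symm
        · by_contra hh
          exact a2 (not_le.mp hh) hxx
      rw [rkOf_inj T this]
  have := Finset.card_le_card_sdiff_add_card (s := Cset S T f) (t := Dset S T f)
  omega

lemma mem_isolNbrs_iff {L R D : Type*} [Fintype D] (nbr : L → D → R) (S : Finset L)
    (x : L) (u : R) : u ∈ isolNbrs nbr S x ↔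
      (∃ j, nbr x j = u) ∧ ∀ z ∈ S, z ≠ x → ∀ j, nbr z j ≠ u := by
  simp [isolNbrs]

open Classical in
lemma bad_coll {N B d : ℕ} (S : Finset (Fin N)) (f : Fin N → Fin d → Fin B) (ζ : ℝ) (x : Fin N)
    (h : ((isolNbrs (oneLayerNbr f) S x).card : ℝ) < (1 - ζ) * d) :
    ζ * d ≤ ((Finset.univ.filter (fun j : Fin d => ∃ z ∈ S, z ≠ x ∧ f z j = f x j)).card : ℝ) := by
  have h1 : (Finset.univ.filter (fun j : Fin d => ¬ ∃ z ∈ S, z ≠ x ∧ f z j = f x j)).card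
      ≤ (isolNbrs (oneLayerNbr f) S x).card := by
    refine Finset.card_le_card_of_injOn (fun j => (f x j, j)) ?_ ?_
    · intro j hj
      simp only [Finset.coe_filter, Finset.mem_univ, true_and, Set.mem_ofPred_eq, not_exists,
        not_and] at hj
      refine Finset.mem_coe.mpr ((mem_isolNbrs_iff _ _ _ _).mpr ⟨⟨j, rfl⟩, ?_⟩)
      intro z hz hzx j' he
      simp only [oneLayerNbr, Prod.mk.injEq] at he
      obtain ⟨he, rfl⟩ := he
      exact hj z hz hzx he
    · intro j _ j' _ he
      exact (Prod.mk.inj he).2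
  have h2 := Finset.card_filter_add_card_filter_not (s := (Finset.univ : Finset (Fin d)))
    (fun j : Fin d => ∃ z ∈ S, z ≠ x ∧ f z j = f x j)
  rw [Finset.card_univ, Fintype.card_fin] at h2
  have h1' : ((Finset.univ.filter
    (fun j : Fin d => ¬ ∃ z ∈ S, z ≠ x ∧ f z j = f x j)).card : ℝ)
      ≤ (isolNbrs (oneLayerNbr f) S x).card := by exact_mod_cast h1
  have h2' : ((Finset.univ.filter (fun j : Fin d => ∃ z ∈ S, z ≠ x ∧ f z j = f x j)).card : ℝ)
    + ((Finset.univ.filter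
      (fun j : Fin d => ¬ ∃ z ∈ S, z ≠ x ∧ f z j = f x j)).card : ℝ) = d := by exact_mod_cast h2
  linarith

open Classical in
lemma Cset_card {N B d : ℕ} (S T : Finset (Fin N)) (f : Fin N → Fin d → Fin B) :
    (Cset S T f).card =
      ∑ x ∈ T, (Finset.univ.filter (fun j : Fin d => ∃ z ∈ S, z ≠ x ∧ f z j = f x j)).card := by
  unfold Cset
  simp only [Finset.card_filter, Finset.sum_product]

open Classical in
lemma not_isol {N B d : ℕ} (L₀ : ℕ) (ε ζ : ℝ) (f : Fin N → Fin d → Fin B)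
    (h : ¬ HasIsolation L₀ ε ζ (oneLayerNbr f)) :
    ∃ S : Finset (Fin N), ∃ T ⊆ S, S.card ≤ L₀ ∧ ε * S.card < T.card ∧
      ζ * T.card * d / 2 ≤ ((Dset S T f).card : ℝ) := by
  unfold HasIsolation at h
  push Not at h
  obtain ⟨S, hS, h⟩ := h
  refine ⟨S, S.filter (fun x => ((isolNbrs (oneLayerNbr f) S x).card : ℝ) < (1 - ζ) * d),
    Finset.filter_subset _ _, hS, ?_, ?_⟩
  · by_contra hc
    have h2 := Finset.card_filter_add_card_filter_not (s := S)
      (fun x => ((isolNbrs (oneLayerNbr f) S x).card : ℝ) < (1 - ζ) * d)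
    have h2' : ((S.filter (fun x =>
        ((isolNbrs (oneLayerNbr f) S x).card : ℝ) < (1 - ζ) * d)).card : ℝ) + 
        ((S.filter (fun x =>
        ¬ ((isolNbrs (oneLayerNbr f) S x).card : ℝ) < (1 - ζ) * d)).card : ℝ) = S.card := by
      exact_mod_cast h2
    obtain ⟨x, hx, hlt⟩ := h (S.filter (fun x =>
        ¬ ((isolNbrs (oneLayerNbr f) S x).card : ℝ) < (1 - ζ) * d)) (Finset.filter_subset _ _)
        (by linarith)
    rw [Fintype.card_fin] at hlt
    exact (Finset.mem_filter.mp hx).2 hlt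
  · set T := S.filter (fun x => ((isolNbrs (oneLayerNbr f) S x).card : ℝ) < (1 - ζ) * d) with hT
    have h1 := halving S T (Finset.filter_subset _ _) f
    have h1' : ((Cset S T f).card : ℝ) ≤ 2 * (Dset S T f).card := by exact_mod_cast h1
    have h3 : (T.card : ℝ) * (ζ * d) ≤ (Cset S T f).card := by
      rw [Cset_card, Nat.cast_sum, ← nsmul_eq_mul]
      apply Finset.card_nsmul_le_sum
      intro x hx
      exact bad_coll S f ζ x (Finset.mem_filter.mp hx).2
    linarith

lemma choose_exp (n q : ℕ) : (n.choose q : ℝ) * (q : ℝ) ^ q ≤ (Real.exp 1 * n) ^ q := by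
  have h1 : (n.choose q : ℝ) ≤ (n : ℝ) ^ q / (q.factorial : ℝ) := Nat.choose_le_pow_div q n
  have h2 := Real.pow_div_factorial_le_exp (q : ℝ) (by positivity) q
  have h3 : Real.exp (q : ℝ) = Real.exp 1 ^ q := by rw [← Real.exp_nat_mul]; simp
  rw [h3] at h2
  calc (n.choose q : ℝ) * (q : ℝ) ^ q ≤ ((n : ℝ) ^ q / (q.factorial : ℝ)) * (q : ℝ) ^ q := by gcongr
    _ = ((q : ℝ) ^ q / (q.factorial : ℝ)) * (n : ℝ) ^ q := by ring
    _ ≤ Real.exp 1 ^ q * (n : ℝ) ^ q := by gcongr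
    _ = _ := by rw [mul_pow]

open Classical in
/-- number of instances with at least `q` pairs in `Dset`. -/
lemma count_D {N B d : ℕ} (S T : Finset (Fin N)) (q : ℕ) :
    (Finset.univ.filter (fun f : Fin N → Fin d → Fin B => q ≤ (Dset S T f).card)).card * B ^ q
      ≤ (T.card * d).choose q * (S.card ^ q * Fintype.card (Fin N → Fin d → Fin B)) := by
  set E : Finset (Fin N × Fin d) → Finset (Fin N → Fin d → Fin B) := fun P =>
    Finset.univ.filter (fun f : Fin N → Fin d → Fin B =>
      ∀ p ∈ P, ∃ z ∈ S, rkOf T z < rkOf T p.1 ∧ f z p.2 = f p.1 p.2) with hE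
  set I := (T ×ˢ (Finset.univ : Finset (Fin d))).powersetCard q with hI
  have hsub : (Finset.univ.filter (fun f : Fin N → Fin d → Fin B => q ≤ (Dset S T f).card))
      ⊆ I.biUnion E := by
    intro f hf
    simp only [Finset.mem_filter, Finset.mem_univ, true_and] at hf
    obtain ⟨P, hP, hPc⟩ := Finset.exists_subset_card_eq hf
    simp only [Finset.mem_biUnion, hI, hE, Finset.mem_powersetCard, Finset.mem_filter,
      Finset.mem_univ, true_and]
    exact ⟨P, ⟨hP.trans (Finset.filter_subset _ _), hPc⟩,
      fun p hp => (Finset.mem_filter.mp (hP hp)).2⟩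
  calc _ ≤ (I.biUnion E).card * B ^ q :=
        Nat.mul_le_mul_right _ (Finset.card_le_card hsub)
    _ ≤ (∑ P ∈ I, (E P).card) * B ^ q := Nat.mul_le_mul_right _ Finset.card_biUnion_le
    _ = ∑ P ∈ I, (E P).card * B ^ q := Finset.sum_mul _ _ _
    _ ≤ ∑ P ∈ I, S.card ^ q * Fintype.card (Fin N → Fin d → Fin B) := by
        refine Finset.sum_le_sum fun P hP => ?_
        have := count_constraint (B := B) S T P
        rwa [(Finset.mem_powersetCard.mp hP).2] at this
    _ = _ := by
        rw [Finset.sum_const, smul_eq_mul, hI, Finset.card_powersetCard, Finset.card_product,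
          Finset.card_univ, Fintype.card_fin]

open Classical in
lemma pair_bound {N B d : ℕ} (S T : Finset (Fin N)) (ζ : ℝ) (hζ : 0 < ζ) (hT : 0 < T.card)
    (hd : 0 < d) (hB : 0 < B) (q : ℕ) (hq : ζ * T.card * d / 2 ≤ q) :
    ((Finset.univ.filter (fun f : Fin N → Fin d → Fin B => q ≤ (Dset S T f).card)).card : ℝ)
      ≤ (2 * Real.exp 1 * S.card / (ζ * B)) ^ q * Fintype.card (Fin N → Fin d → Fin B) := by
  have h1 : ((Finset.univ.filter (fun f : Fin N → Fin d → Fin B => q ≤ (Dset S T f).card)).card : ℝ)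
      * (B : ℝ) ^ q ≤ ((T.card * d).choose q : ℝ) *
        ((S.card : ℝ) ^ q * Fintype.card (Fin N → Fin d → Fin B)) := by
    exact_mod_cast count_D (B := B) S T q
  have h2 := choose_exp (T.card * d) q
  have hT' : (0 : ℝ) < T.card := by exact_mod_cast hT
  have hd' : (0 : ℝ) < d := by exact_mod_cast hd
  have hB' : (0 : ℝ) < B := by exact_mod_cast hB
  set m : ℝ := ζ * T.card * d / 2 with hm
  have hmpos : 0 < m := by positivity
  have h3 : ((T.card * d).choose q : ℝ) ≤ (2 * Real.exp 1 / ζ) ^ q := by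
    have h4 : ((T.card * d).choose q : ℝ) * m ^ q ≤ (2 * Real.exp 1 / ζ) ^ q * m ^ q := by
      calc ((T.card * d).choose q : ℝ) * m ^ q ≤ ((T.card * d).choose q : ℝ) * (q : ℝ) ^ q := by
            gcongr
        _ ≤ _ := h2
        _ = _ := by
            rw [← mul_pow]
            congr 1
            rw [hm]
            push_cast
            field_simp
    exact le_of_mul_le_mul_right h4 (by positivity)
  have h5 : ((Finset.univ.filter
      (fun f : Fin N → Fin d → Fin B => q ≤ (Dset S T f).card)).card : ℝ) * (B : ℝ) ^ q ≤
      ((2 * Real.exp 1 * S.card / (ζ * B)) ^ q * Fintype.card (Fin N → Fin d → Fin B))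
        * (B : ℝ) ^ q := by
    refine h1.trans ?_
    calc _ ≤ (2 * Real.exp 1 / ζ) ^ q *
        ((S.card : ℝ) ^ q * Fintype.card (Fin N → Fin d → Fin B)) := by gcongr
      _ = (2 * Real.exp 1 / ζ * S.card) ^ q * Fintype.card (Fin N → Fin d → Fin B) := by
          rw [mul_pow]; ring
      _ = ((2 * Real.exp 1 * S.card / (ζ * B)) * B) ^ q *
          Fintype.card (Fin N → Fin d → Fin B) := by
          congr 2
          field_simp
      _ = _ := by rw [mul_pow]; ring
  exact le_of_mul_le_mul_right h5 (by positivity)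

set_option maxHeartbeats 1000000 in
lemma numeric (A ε ζ : ℝ) (hA : 1 ≤ A) (hε : 0 < ε) (hε1 : ε < 1/4) (hζ : 0 < ζ)
    (k N B d s q : ℕ) (hk : 1 ≤ k) (hN : (N : ℝ) ≥ 108 * A * k / ε)
    (hB : (B : ℝ) ≥ 108 * A * k / (ζ * ε))
    (hd : (d : ℝ) ≥ 108 * A * (1 / (ζ * ε)) * Real.log ((N : ℝ) / k))
    (hs : 1 ≤ s) (hsN : s ≤ N) (hsL : s ≤ Nat.ceil (A * k / ε))
    (hq : ζ * (ε * s) * d / 2 ≤ q) :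
    (2 * Real.exp 1 * s / (ζ * B)) ^ q * 2 ^ s * (N.choose s : ℝ) ≤ Real.exp (-(3 * Real.log N)) := by
  have he := Real.exp_one_lt_three
  have hs' : (1 : ℝ) ≤ s := by exact_mod_cast hs
  have hk' : (1 : ℝ) ≤ k := by exact_mod_cast hk
  have hsN' : (s : ℝ) ≤ N := by exact_mod_cast hsN
  have hNpos : (0 : ℝ) < N := by linarith
  have hBpos : (0 : ℝ) < B := lt_of_lt_of_le (by positivity) hB
  have hAk : 1 ≤ A * k / ε := by
    rw [le_div_iff₀ hε]; nlinarith
  have hsA : ε * s ≤ 2 * A * k := by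
    have h1 : (s : ℝ) ≤ Nat.ceil (A * k / ε) := by exact_mod_cast hsL
    have h2 := Nat.ceil_lt_add_one (a := A * k / ε) (by positivity)
    have h3 : (s : ℝ) ≤ 2 * (A * k / ε) := by linarith
    calc ε * s ≤ ε * (2 * (A * k / ε)) := by gcongr
      _ = _ := by field_simp
  set a := Real.log ((N : ℝ) / k) with ha
  set b := Real.log (108 * A * k / (2 * Real.exp 1 * ε * s)) with hb
  set L := Real.log (Real.exp 1 * N / s) with hL
  have hexp2 : Real.exp 2 ≤ 9 := by
    have : Real.exp 2 = Real.exp 1 * Real.exp 1 := by rw [← Real.exp_add]; norm_num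
    rw [this]; nlinarith [Real.exp_pos 1]
  have ha2 : 2 ≤ a := by
    rw [ha, Real.le_log_iff_exp_le (by positivity)]
    refine hexp2.trans ?_
    rw [le_div_iff₀ (by positivity)]
    refine le_trans ?_ hN
    rw [le_div_iff₀ hε]
    nlinarith [mul_le_mul hA hk' (by norm_num) (by linarith)]
  have hb2 : 2 ≤ b := by
    rw [hb, Real.le_log_iff_exp_le (by positivity)]
    refine hexp2.trans ?_
    rw [le_div_iff₀ (by positivity)]
    calc 9 * (2 * Real.exp 1 * ε * s) = 18 * Real.exp 1 * (ε * s) := by ring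
      _ ≤ 18 * 3 * (2 * A * k) := by gcongr
      _ = 108 * A * k := by ring
  have hL1 : L = 1 + Real.log (N / s) := by
    rw [hL, mul_div_assoc, Real.log_mul (by positivity) (by positivity), Real.log_exp]
  have hlogNs : 0 ≤ Real.log (N / s) := Real.log_nonneg (by rw [le_div_iff₀ (by positivity)]; linarith)
  have hLge : 1 ≤ L := by linarith
  have hsL2 : Real.log N ≤ s * L := by
    have h1 : Real.log N = Real.log s + Real.log (N / s) := by
      rw [← Real.log_mul (by positivity) (by positivity)]
      congr 1; field_simp
    have h2 := Real.log_le_sub_one_of_pos (show (0 : ℝ) < s by linarith)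
    rw [h1, hL1]
    nlinarith
  have hab : L ≤ a + b := by
    rw [ha, hb, hL, ← Real.log_mul (by positivity) (by positivity)]
    apply Real.log_le_log (by positivity)
    have : (N : ℝ) / k * (108 * A * k / (2 * Real.exp 1 * ε * s))
      = (108 * A / (2 * Real.exp 1 * ε)) * N / s := by field_simp
    rw [this]
    gcongr
    rw [le_div_iff₀ (by positivity)]
    calc Real.exp 1 * (2 * Real.exp 1 * ε) ≤ 3 * (2 * 3 * 1) := by gcongr; linarith
      _ ≤ 108 * A := by linarith
  have hqa : 54 * A * s * a ≤ q := by
    refine le_trans ?_ hq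
    calc 54 * A * s * a = ζ * (ε * s) * (108 * A * (1 / (ζ * ε)) * a) / 2 := by
          field_simp; norm_num
      _ ≤ _ := by gcongr
  have hρ : 2 * Real.exp 1 * s / (ζ * B) ≤ Real.exp (-b) := by
    rw [Real.exp_neg, hb, Real.exp_log (by positivity), inv_div,
      div_le_div_iff₀ (by positivity) (by positivity)]
    have hB2 : 108 * A * k ≤ B * (ζ * ε) := by
      rwa [ge_iff_le, div_le_iff₀ (by positivity)] at hB
    calc 2 * Real.exp 1 * s * (108 * A * k) ≤ 2 * Real.exp 1 * s * (B * (ζ * ε)) := by gcongr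
      _ = _ := by ring
  have t1 : (2 * Real.exp 1 * s / (ζ * B)) ^ q ≤ Real.exp (-(b * q)) := by
    calc _ ≤ (Real.exp (-b)) ^ q := by gcongr
      _ = _ := by rw [← Real.exp_nat_mul]; congr 1; ring
  have t2 : (2 : ℝ) ^ s ≤ Real.exp s := by
    have : Real.exp (s : ℝ) = Real.exp 1 ^ s := by rw [← Real.exp_nat_mul]; simp
    rw [this]
    gcongr
    linarith [Real.add_one_le_exp (1 : ℝ)]
  have t3 : (N.choose s : ℝ) ≤ Real.exp (s * L) := by
    rw [Real.exp_nat_mul, hL, Real.exp_log (by positivity), div_pow, le_div_iff₀ (by positivity)]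
    exact choose_exp N s
  calc _ ≤ Real.exp (-(b * q)) * Real.exp s * Real.exp (s * L) := by gcongr
    _ = Real.exp (-(b * q) + s + s * L) := by rw [Real.exp_add, Real.exp_add]
    _ ≤ _ := by
      apply Real.exp_le_exp.mpr
      have u1 : b * (54 * A * s * a) ≤ b * q := by gcongr
      have u2 : a + b ≤ 2 * (a * b) := by nlinarith
      have u3 : s * L ≤ s * (2 * (a * b)) := by gcongr; linarith
      have u4 : s * (2 * (a * b)) * 27 ≤ s * (2 * (a * b)) * (27 * A) := by
        apply mul_le_mul_of_nonneg_left (by linarith)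
        have : 0 ≤ a * b := by nlinarith
        positivity
      have u5 : (s : ℝ) ≤ s * L := by nlinarith
      have u6 : b * (54 * A * s * a) = s * (2 * (a * b)) * (27 * A) := by ring
      linarith

open Classical in
/-- One-layer isolation property (Lemma B.2), stated by counting instances of the
one-layer hashing scheme. -/
theorem one_layer_isolation :
    ∀ A : ℝ, 1 ≤ A →
    ∃ C c : ℝ, 0 < C ∧ 0 < c ∧
      ∀ ε ζ : ℝ, 0 < ε → ε < 1/4 → 0 < ζ → ζ < 1/4 →
      ∀ k : ℕ, 1 ≤ k →
      ∀ N : ℕ, (N : ℝ) ≥ C * k / ε →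
      ∀ B d : ℕ,
        (B : ℝ) ≥ C * k / (ζ * ε) →
        (d : ℝ) ≥ C * (1 / (ζ * ε)) * Real.log ((N : ℝ) / k) →
        ((Finset.univ.filter (fun f : Fin N → Fin d → Fin B =>
            HasIsolation (Nat.ceil (A * k / ε)) ε ζ (oneLayerNbr f))).card : ℝ)
          ≥ (1 - (N : ℝ) ^ (-c)) * (Fintype.card (Fin N → Fin d → Fin B)) := by
  intro A hA
  refine ⟨108 * A, 1, by linarith, one_pos, ?_⟩
  intro ε ζ hε hε1 hζ hζ1 k hk N hN B d hB hd
  have hk' : (1 : ℝ) ≤ k := by exact_mod_cast hk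
  have hNk : (108 : ℝ) * k ≤ N := by
    refine le_trans ?_ hN
    rw [le_div_iff₀ hε]
    nlinarith [mul_le_mul hA hk' (by norm_num) (by linarith)]
  have hNpos : (108 : ℝ) ≤ N := by linarith
  have hB0 : 0 < B := by
    have : (0 : ℝ) < B := lt_of_lt_of_le (by positivity) hB
    exact_mod_cast this
  have hd0 : 0 < d := by
    have h1 : 0 < Real.log ((N : ℝ) / k) := by
      apply Real.log_pos
      rw [lt_div_iff₀ (by positivity)]
      linarith
    have : (0 : ℝ) < d := lt_of_lt_of_le (by positivity) hd
    exact_mod_cast this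
  set L₀ := Nat.ceil (A * k / ε) with hL₀
  set tot : ℝ := (Fintype.card (Fin N → Fin d → Fin B) : ℝ) with htot
  have htot0 : 0 ≤ tot := by positivity
  set Q : Finset (Fin N) → ℕ := fun T => ⌈ζ * T.card * d / 2⌉₊ with hQ
  set F : Finset (Fin N) → Finset (Fin N) → Finset (Fin N → Fin d → Fin B) := fun S T =>
    Finset.univ.filter (fun f => S.card ≤ L₀ ∧ ε * S.card < T.card ∧ Q T ≤ (Dset S T f).card)
    with hF
  set g : ℕ → ℝ := fun s => if s = 0 then 0 else
    Real.exp (-(3 * Real.log N)) / (2 ^ s * (N.choose s : ℝ)) * tot with hg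
  have hFb : ∀ S T, T ⊆ S → ((F S T).card : ℝ) ≤ g S.card := by
    intro S T hTS
    by_cases hc : S.card ≤ L₀ ∧ ε * S.card < T.card
    · obtain ⟨hc1, hc2⟩ := hc
      have hT0 : 0 < T.card := by
        have : (0 : ℝ) < T.card := lt_of_le_of_lt (by positivity) hc2
        exact_mod_cast this
      have hS0 : 0 < S.card := lt_of_lt_of_le hT0 (Finset.card_le_card hTS)
      have hSN : S.card ≤ N := by simpa using Finset.card_le_univ S
      have hq : ζ * T.card * d / 2 ≤ (Q T : ℝ) := Nat.le_ceil _
      have h1 := pair_bound (B := B) S T ζ hζ hT0 hd0 hB0 (Q T) hq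
      have h2 := numeric A ε ζ hA hε hε1 hζ k N B d S.card (Q T) hk hN hB hd hS0 hSN hc1
        (le_trans (by gcongr) hq)
      have hch : (0 : ℝ) < N.choose S.card := by exact_mod_cast Nat.choose_pos hSN
      have h3 : ((F S T).card : ℝ) ≤ ((Finset.univ.filter
          (fun f : Fin N → Fin d → Fin B => Q T ≤ (Dset S T f).card)).card : ℝ) := by
        have : F S T ⊆ Finset.univ.filter
          (fun f : Fin N → Fin d → Fin B => Q T ≤ (Dset S T f).card) := by
          intro f hf
          simp only [hF, Finset.mem_filter, Finset.mem_univ, true_and] at hf ⊢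
          exact hf.2.2
        exact_mod_cast Finset.card_le_card this
      refine h3.trans (h1.trans ?_)
      simp only [hg, hS0.ne', if_false]
      refine mul_le_mul_of_nonneg_right ?_ htot0
      rw [le_div_iff₀ (by positivity), ← mul_assoc]
      exact h2
    · have : F S T = ∅ := by
        apply Finset.filter_eq_empty_iff.mpr
        intro f _ h
        exact hc ⟨h.1, h.2.1⟩
      rw [this]
      simp only [hg, Finset.card_empty, Nat.cast_zero]
      split_ifs <;> positivity
  have hsub : Finset.univ.filter (fun f : Fin N → Fin d → Fin B =>
      ¬ HasIsolation L₀ ε ζ (oneLayerNbr f)) ⊆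
      (Finset.univ : Finset (Fin N)).powerset.biUnion (fun S => S.powerset.biUnion (F S)) := by
    intro f hf
    simp only [Finset.mem_filter, Finset.mem_univ, true_and] at hf
    obtain ⟨S, T, hTS, h1, h2, h3⟩ := not_isol L₀ ε ζ f hf
    simp only [Finset.mem_biUnion, Finset.mem_powerset, hF, Finset.mem_filter, Finset.mem_univ,
      true_and]
    exact ⟨S, Finset.subset_univ _, T, hTS, h1, h2, Nat.ceil_le.mpr h3⟩
  have hbad : ((Finset.univ.filter (fun f : Fin N → Fin d → Fin B =>
      ¬ HasIsolation L₀ ε ζ (oneLayerNbr f))).card : ℝ) ≤ (N : ℝ) ^ (-(1 : ℝ)) * tot := by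
    have hb1 : ((Finset.univ.filter (fun f : Fin N → Fin d → Fin B =>
        ¬ HasIsolation L₀ ε ζ (oneLayerNbr f))).card : ℝ) ≤
        ∑ S ∈ (Finset.univ : Finset (Fin N)).powerset, ∑ T ∈ S.powerset, ((F S T).card : ℝ) := by
      have := (Finset.card_le_card hsub).trans (Finset.card_biUnion_le.trans
        (Finset.sum_le_sum fun S _ => Finset.card_biUnion_le))
      exact_mod_cast this
    have hb2 : ∑ S ∈ (Finset.univ : Finset (Fin N)).powerset, ∑ T ∈ S.powerset,
        ((F S T).card : ℝ) ≤ ∑ S ∈ (Finset.univ : Finset (Fin N)).powerset,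
          (2 : ℝ) ^ S.card * g S.card := by
      refine Finset.sum_le_sum fun S _ => ?_
      calc _ ≤ ∑ T ∈ S.powerset, g S.card :=
            Finset.sum_le_sum fun T hT => hFb S T (Finset.mem_powerset.mp hT)
        _ = _ := by simp [Finset.card_powerset]
    have hb3 := Finset.sum_powerset_apply_card (fun s => (2 : ℝ) ^ s * g s)
      (x := (Finset.univ : Finset (Fin N)))
    rw [Finset.card_univ, Fintype.card_fin] at hb3
    rw [hb3] at hb2
    refine hb1.trans (hb2.trans ?_)
    have hb4 : ∀ s ∈ Finset.range (N + 1), N.choose s • ((2 : ℝ) ^ s * g s) ≤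
        Real.exp (-(3 * Real.log N)) * tot := by
      intro s hs
      have hsN : s ≤ N := Nat.lt_succ_iff.mp (Finset.mem_range.mp hs)
      have hch : (0 : ℝ) < N.choose s := by exact_mod_cast Nat.choose_pos hsN
      simp only [hg]
      split_ifs
      · simp only [mul_zero, smul_zero]; positivity
      · rw [nsmul_eq_mul]
        apply le_of_eq
        field_simp
    refine (Finset.sum_le_card_nsmul _ _ _ hb4).trans ?_
    rw [Finset.card_range, nsmul_eq_mul, ← mul_assoc]
    refine mul_le_mul_of_nonneg_right ?_ htot0
    have hN0 : (0 : ℝ) < N := by linarith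
    have he : Real.exp (-(3 * Real.log N)) = ((N : ℝ) ^ 3)⁻¹ := by
      rw [Real.exp_neg, show 3 * Real.log (N : ℝ) = ((3 : ℕ) : ℝ) * Real.log N by norm_num,
        Real.exp_nat_mul, Real.exp_log hN0]
    rw [he, Real.rpow_neg_one, ← div_eq_mul_inv, ← one_div,
      div_le_div_iff₀ (by positivity) (by positivity)]
    push_cast
    nlinarith [mul_pos hN0 hN0]
  have hsum := Finset.card_filter_add_card_filter_not
    (s := (Finset.univ : Finset (Fin N → Fin d → Fin B)))
    (fun f => HasIsolation L₀ ε ζ (oneLayerNbr f))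
  rw [Finset.card_univ] at hsum
  have hsum' : ((Finset.univ.filter (fun f : Fin N → Fin d → Fin B =>
      HasIsolation L₀ ε ζ (oneLayerNbr f))).card : ℝ) +
      ((Finset.univ.filter (fun f : Fin N → Fin d → Fin B =>
      ¬ HasIsolation L₀ ε ζ (oneLayerNbr f))).card : ℝ) = tot := by
    rw [htot]
    exact_mod_cast hsum
  linarith
end

section
/- Flat-block noise bound: Let G be an (n, m, d, ℓ, ε)-bipartite expander with adjacency matrix Φ ∈ {0,1}^{m×n}, and let S, T ⊆ [n] be disjoint nonempty sets with |S| ≤ |T| and |S| + |T| ≤ ℓ. Let x ∈ ℝⁿ be supported on T and flat in the sense that min_{i∈T}|x_i| ≥ (1/2)·max_{i∈T}|x_i|. Then ‖(Φx)_{Γ(S)}‖₁ ≤ 4εd‖x‖₁, where Γ(S) is the set of neighbours of S and (v)_{Γ(S)} denotes the restriction of v ∈ ℝ^m to the coordinates in Γ(S) (zero elsewhere). -/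
noncomputable def l1 {n : ℕ} (x : Fin n → ℝ) : ℝ := ∑ i, |x i|

open Classical in
/-- `(Φx)_u`, the sum of `x` over the left vertices adjacent to the right node `u`. -/
noncomputable def bucketSum {L R D : Type*} [Fintype L] [Fintype D] (nbr : L → D → R)
    (x : L → ℝ) (u : R) : ℝ :=
  ∑ i ∈ Finset.univ.filter (fun i => ∃ j, nbr i j = u), x i

/-- Flat-block noise bound: if `x` is supported on `T` and flat on `T`, then the `ℓ₁`
mass of `Φx` restricted to `Γ(S)` is at most `4εd‖x‖₁`. -/
theorem flat_block_noise
    {n m d : ℕ} (ℓ : ℕ) (ε : ℝ)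
    (nbr : Fin n → Fin d → Fin m)
    (hexp : IsExpander (ℓ : ℝ) ε nbr)
    (S T : Finset (Fin n)) (hdisj : Disjoint S T)
    (hSne : S.Nonempty) (hTne : T.Nonempty)
    (hST : S.card ≤ T.card) (hcard : S.card + T.card ≤ ℓ)
    (x : Fin n → ℝ)
    (hsupp : ∀ i ∉ T, x i = 0)
    (hflat : ∀ i ∈ T, ∀ j ∈ T, |x j| / 2 ≤ |x i|) :
    ∑ u ∈ nbrSet nbr S, |bucketSum nbr x u| ≤ 4 * ε * d * l1 x := by
  classical
  set A := nbrSet nbr S with hA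
  let N : Fin n → Finset (Fin m) := fun i => Finset.image (nbr i) Finset.univ
  have hN : ∀ i, (N i).card ≤ d := fun i => by
    simpa using (Finset.card_image_le (s := (Finset.univ : Finset (Fin d))) (f := nbr i))
  have hnbr : ∀ U : Finset (Fin n), nbrSet nbr U = U.biUnion N := by
    intro U
    ext u
    simp [nbrSet, N]
  have hAcard : (A.card : ℝ) ≤ d * S.card := by
    have h : A.card ≤ S.card * d := by
      rw [hA, hnbr]
      exact Finset.card_biUnion_le_card_mul _ _ _ (fun i _ => hN i)
    have h2 : (A.card : ℝ) ≤ S.card * d := by exact_mod_cast h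
    linarith
  -- nonnegativity of `ε d`
  have hεd : 0 ≤ ε * d := by
    obtain ⟨i, hi⟩ := hSne
    have hSpos : 1 ≤ S.card := Finset.card_pos.mpr ⟨i, hi⟩
    have h := hexp {i} (by
      rw [Finset.card_singleton]
      exact_mod_cast (by omega : 1 ≤ ℓ))
    rw [hnbr, Finset.singleton_biUnion, Finset.card_singleton, Fintype.card_fin] at h
    have h2 : ((N i).card : ℝ) ≤ d := by exact_mod_cast hN i
    push_cast at h
    linarith
  -- counting edges from `T` into `A`
  have hE : (∑ i ∈ T, ((N i ∩ A).card : ℝ)) ≤ 2 * (ε * d) * T.card := by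
    have h := hexp (S ∪ T) (by
      rw [Finset.card_union_of_disjoint hdisj]
      exact_mod_cast hcard)
    rw [Finset.card_union_of_disjoint hdisj, Fintype.card_fin] at h
    have hsub : nbrSet nbr (S ∪ T) ⊆ A ∪ T.biUnion (fun i => N i \ A) := by
      intro u hu
      rw [hnbr, Finset.mem_biUnion] at hu
      obtain ⟨i, hi, hiu⟩ := hu
      by_cases huA : u ∈ A
      · exact Finset.mem_union_left _ huA
      · apply Finset.mem_union_right
        rcases Finset.mem_union.mp hi with hi | hi
        · exact absurd (by rw [hA, hnbr]; exact Finset.mem_biUnion.mpr ⟨i, hi, hiu⟩) huA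
        · exact Finset.mem_biUnion.mpr ⟨i, hi, Finset.mem_sdiff.mpr ⟨hiu, huA⟩⟩
    have hc : (nbrSet nbr (S ∪ T)).card ≤ A.card + ∑ i ∈ T, (N i \ A).card :=
      (Finset.card_le_card hsub).trans ((Finset.card_union_le _ _).trans
        (Nat.add_le_add_left Finset.card_biUnion_le _))
    have hc' : ((nbrSet nbr (S ∪ T)).card : ℝ) ≤ A.card + ∑ i ∈ T, ((N i \ A).card : ℝ) := by
      exact_mod_cast hc
    have hs : ∑ i ∈ T, ((N i \ A).card : ℝ) + ∑ i ∈ T, ((N i ∩ A).card : ℝ) ≤ T.card * d := by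
      rw [← Finset.sum_add_distrib, ← nsmul_eq_mul]
      apply Finset.sum_le_card_nsmul
      intro i _
      have := Finset.card_sdiff_add_card_inter (N i) A
      have h3 := hN i
      exact_mod_cast (by omega : (N i \ A).card + (N i ∩ A).card ≤ d)
    have hST' : (S.card : ℝ) ≤ T.card := by exact_mod_cast hST
    have := mul_le_mul_of_nonneg_left hST' hεd
    push_cast at h
    nlinarith
  obtain ⟨k, hk, hmax⟩ := Finset.exists_max_image T (fun i => |x i|) hTne
  have hl1 : (T.card : ℝ) * (|x k| / 2) ≤ l1 x := by
    have h1 : (T.card : ℝ) * (|x k| / 2) ≤ ∑ i ∈ T, |x i| := by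
      rw [← nsmul_eq_mul]
      exact Finset.card_nsmul_le_sum _ _ _ (fun i hi => hflat i hi k hk)
    exact h1.trans (Finset.sum_le_univ_sum_of_nonneg (fun i => abs_nonneg _))
  have hb : ∀ u, |bucketSum nbr x u| ≤ ∑ i ∈ T, if u ∈ N i then |x k| else 0 := by
    intro u
    have e : bucketSum nbr x u = ∑ i ∈ T, if u ∈ N i then x i else 0 := by
      have e1 : bucketSum nbr x u = ∑ i, if u ∈ N i then x i else 0 := by
        simp only [bucketSum, N, Finset.mem_image, Finset.mem_univ, true_and]
        rw [Finset.sum_filter]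
        refine Finset.sum_congr rfl fun i _ => ?_
        congr
      rw [e1]
      symm
      apply Finset.sum_subset (Finset.subset_univ _)
      intro i _ hi
      simp [hsupp i hi]
    rw [e]
    refine (Finset.abs_sum_le_sum_abs _ _).trans (Finset.sum_le_sum ?_)
    intro i hi
    split_ifs
    · exact hmax i hi
    · simp
  calc ∑ u ∈ A, |bucketSum nbr x u|
      ≤ ∑ u ∈ A, ∑ i ∈ T, (if u ∈ N i then |x k| else 0) := Finset.sum_le_sum fun u _ => hb u
    _ = (∑ i ∈ T, ((N i ∩ A).card : ℝ)) * |x k| := by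
        rw [Finset.sum_comm, Finset.sum_mul]
        refine Finset.sum_congr rfl fun i _ => ?_
        rw [← Finset.sum_filter, Finset.sum_const, nsmul_eq_mul, Finset.filter_mem_eq_inter,
          Finset.inter_comm]
    _ ≤ (2 * (ε * d) * T.card) * |x k| := mul_le_mul_of_nonneg_right hE (abs_nonneg _)
    _ = 4 * (ε * d) * (T.card * (|x k| / 2)) := by ring
    _ ≤ 4 * (ε * d) * l1 x := mul_le_mul_of_nonneg_left hl1 (by linarith)
    _ = 4 * ε * d * l1 x := by ring
end

section
/- Collision probability bound for uniform hashing: Let b₁, …, b_s be independent random variables, each uniformly distributed on [B]. Then for every integer 0 ≤ Y ≤ s, the probability that the number of distinct values among b₁, …, b_s equals Y is at most binom(s, s−Y)·(s/B)^{s−Y}. -/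
open Classical in
/-- Rebuild a function from its values on `T` and pointers from the complement of `T`. -/
noncomputable def rebuildFun {s B : ℕ} (hB : 0 < B) (T : Finset (Fin s))
    (p : (T → Fin B) × ({i // i ∉ T} → Fin s)) : Fin s → Fin B := fun i =>
  if h : i ∈ T then p.1 ⟨i, h⟩
  else if h' : p.2 ⟨i, h⟩ ∈ T then p.1 ⟨p.2 ⟨i, h⟩, h'⟩ else ⟨0, hB⟩

open Classical in
theorem count_bound (s B : ℕ) (hB : 0 < B) (Y : ℕ) :
    (Finset.univ.filter (fun f : Fin s → Fin B =>
        (Finset.univ.image f).card = Y)).card ≤ s.choose Y * (B ^ Y * s ^ (s - Y)) := by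
  have hsub : (Finset.univ.filter (fun f : Fin s → Fin B =>
        (Finset.univ.image f).card = Y)) ⊆
      (Finset.powersetCard Y (Finset.univ : Finset (Fin s))).biUnion
        (fun T => Finset.univ.image (rebuildFun hB T)) := by
    intro f hf
    simp only [Finset.mem_filter, Finset.mem_univ, true_and] at hf
    have hex : ∀ b : Finset.univ.image f, ∃ i, f i = b.1 := by
      rintro ⟨b, hb⟩
      simpa using hb
    choose g hg using hex
    have hginj : Function.Injective g := fun a b hab => by
      apply Subtype.ext
      rw [← hg a, ← hg b, hab]
    have hmem : ∀ i, f i ∈ Finset.univ.image f := fun i => by simp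
    simp only [Finset.mem_biUnion, Finset.mem_powersetCard, Finset.subset_univ, true_and,
      Finset.mem_image, Finset.mem_univ]
    refine ⟨Finset.univ.image g, ?_, (fun i => f i, fun i => g ⟨f i, hmem i⟩), ?_⟩
    · rw [Finset.card_image_of_injective _ hginj, Finset.card_univ, Fintype.card_coe, hf]
    · funext i
      unfold rebuildFun
      have h' : g ⟨f i, hmem i⟩ ∈ Finset.univ.image g :=
        Finset.mem_image_of_mem _ (Finset.mem_univ _)
      by_cases h : i ∈ Finset.univ.image g
      · rw [dif_pos h]
      · rw [dif_neg h, dif_pos h']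
        exact hg ⟨f i, hmem i⟩
  refine (Finset.card_le_card hsub).trans ?_
  have := Finset.card_biUnion_le_card_mul
    (Finset.powersetCard Y (Finset.univ : Finset (Fin s)))
    (fun T => Finset.univ.image (rebuildFun hB T)) (B ^ Y * s ^ (s - Y)) ?_
  · simpa using this
  · intro T hT
    have hc := (Finset.mem_powersetCard.1 hT).2
    refine Finset.card_image_le.trans (le_of_eq ?_)
    simp [Fintype.card_subtype_compl, hc]


open Classical in
/-- Collision probability bound for uniform hashing: `s` i.i.d. uniform values in `[B]`
(modelled by a uniformly random function `f : Fin s → Fin B`, so the probability of an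
event is the proportion of functions realizing it) take exactly `Y` distinct values with
probability at most `binom(s, s−Y)·(s/B)^{s−Y}`. -/
theorem collision_probability_bound
    (s B : ℕ) (hB : 0 < B) (Y : ℕ) (hY : Y ≤ s) :
    ((Finset.univ.filter (fun f : Fin s → Fin B =>
        (Finset.univ.image f).card = Y)).card : ℝ) / (Fintype.card (Fin s → Fin B))
      ≤ (Nat.choose s (s - Y)) * ((s : ℝ) / B) ^ (s - Y) := by
  have hB' : (0 : ℝ) < B := by exact_mod_cast hB
  have h : ((Finset.univ.filter (fun f : Fin s → Fin B =>
        (Finset.univ.image f).card = Y)).card : ℝ) ≤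
        s.choose Y * ((B : ℝ) ^ Y * (s : ℝ) ^ (s - Y)) := by
    exact_mod_cast count_bound s B hB Y
  have hcard : ((Fintype.card (Fin s → Fin B) : ℕ) : ℝ) = (B : ℝ) ^ Y * (B : ℝ) ^ (s - Y) := by
    rw [← pow_add, Nat.add_sub_cancel' hY]
    simp
  rw [hcard, Nat.choose_symm hY, div_le_iff₀ (by positivity), div_pow]
  refine h.trans (le_of_eq ?_)
  field_simp
end

section
/- Tail bound for neighbourhood shrinkage under one-layer hashing: Let ε ∈ (0,1) and let B, d, s, N be positive integers with s ≤ N and s < εB. Fix a set S ⊆ [N] with |S| = s, and let f be uniformly distributed over functions [N] → [B]^d. Let Γ(S) = {(f_j(i), j) : i ∈ S, j ∈ [d]} ⊆ [B]×[d] denote the neighbourhood of S in the induced bipartite graph. Then the probability that |Γ(S)| < (1−ε)·d·s is at most (e·s/(ε·B))^{ε·s·d}. -/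
open Classical in
lemma nbr_card {N B d : ℕ} (f : Fin N → Fin d → Fin B) (S : Finset (Fin N)) :
    (nbrSet (oneLayerNbr f) S).card = ∑ j, (S.image (fun i => f i j)).card := by
  have h : nbrSet (oneLayerNbr f) S
      = Finset.univ.biUnion (fun j => (S.image (fun i => f i j)).image (fun b => (b, j))) := by
    ext ⟨b, j⟩
    simp [nbrSet, oneLayerNbr]
  rw [h, Finset.card_biUnion]
  · refine Finset.sum_congr rfl fun j _ => ?_
    exact Finset.card_image_of_injective _ (fun a b hab => (Prod.mk.inj hab).1)
  · intro j _ k _ hjk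
    rw [Function.onFun, Finset.disjoint_left]
    rintro ⟨b, l⟩ h1 h2
    simp only [Finset.mem_image, Prod.mk.injEq] at h1 h2
    obtain ⟨_, _, _, h1⟩ := h1
    obtain ⟨_, _, _, h2⟩ := h2
    exact hjk (h1.trans h2.symm)

lemma sum_update_avg {α β : Type*} [Fintype α] [DecidableEq α] [Fintype β]
    (a : α) (F : (α → β) → ℝ) :
    ∑ f : α → β, ∑ g : β, F (Function.update f a g) = Fintype.card β * ∑ f : α → β, F f := by
  have hinv : Function.Involutive
      (fun p : (α → β) × β => (Function.update p.1 a p.2, p.1 a)) := by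
    rintro ⟨f, g⟩
    simp
  have h := Equiv.sum_comp hinv.toPerm (fun p : (α → β) × β => F p.1)
  rw [Fintype.sum_prod_type, Fintype.sum_prod_type] at h
  simpa [Finset.mul_sum] using h

open Classical in
lemma mgf_bound {N B d s : ℕ} (hB : 0 < B) (y : ℝ) (hy : 0 ≤ y)
    (S : Finset (Fin N)) (hS : S.card ≤ s) :
    ∑ f : Fin N → Fin d → Fin B, ∏ j, y ^ (S.image (fun i => f i j)).card
      ≤ Fintype.card (Fin N → Fin d → Fin B) * ((s : ℝ) / B + y) ^ (d * S.card) := by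
  have hB' : (0 : ℝ) < B := by exact_mod_cast hB
  induction S using Finset.induction_on with
  | empty => simp
  | insert a S ha ih =>
    rw [Finset.card_insert_of_notMem ha] at hS ⊢
    have ih := ih (by omega)
    have key : ∀ f : Fin N → Fin d → Fin B,
        ∑ g : Fin d → Fin B, ∏ j, y ^ ((insert a S).image
            (fun i => Function.update f a g i j)).card
        ≤ (∏ j, y ^ (S.image (fun i => f i j)).card) * (s + B * y) ^ d := by
      intro f
      have h1 : ∀ (g : Fin d → Fin B) (j : Fin d), y ^ ((insert a S).image
            (fun i => Function.update f a g i j)).card =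
          y ^ (S.image (fun i => f i j)).card *
            (if g j ∈ S.image (fun i => f i j) then 1 else y) := by
        intro g j
        have h2 : S.image (fun i => Function.update f a g i j) = S.image (fun i => f i j) := by
          refine Finset.image_congr fun i hi => ?_
          have : i ≠ a := fun h => ha (h ▸ hi)
          simp [Function.update_of_ne this]
        rw [Finset.image_insert, h2, Function.update_self]
        split_ifs with h
        · rw [Finset.insert_eq_of_mem h, mul_one]
        · rw [Finset.card_insert_of_notMem h, pow_succ]
      simp_rw [h1, Finset.prod_mul_distrib]
      rw [← Finset.mul_sum]
      refine mul_le_mul_of_nonneg_left ?_ (Finset.prod_nonneg fun _ _ => pow_nonneg hy _)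
      have h3 := Finset.prod_univ_sum (fun _ : Fin d => (Finset.univ : Finset (Fin B)))
        (fun j b => if b ∈ S.image (fun i => f i j) then (1 : ℝ) else y)
      rw [Fintype.piFinset_univ] at h3
      rw [← h3]
      have h4 : ∀ j ∈ (Finset.univ : Finset (Fin d)),
          ∑ b : Fin B, (if b ∈ S.image (fun i => f i j) then (1 : ℝ) else y) ≤ s + B * y := by
        intro j _
        calc ∑ b : Fin B, (if b ∈ S.image (fun i => f i j) then (1 : ℝ) else y)
            ≤ ∑ b : Fin B, ((if b ∈ S.image (fun i => f i j) then (1 : ℝ) else 0) + y) := by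
              refine Finset.sum_le_sum fun b _ => ?_
              split_ifs <;> linarith
          _ = (S.image (fun i => f i j)).card + B * y := by
              rw [Finset.sum_add_distrib, Finset.sum_ite_mem]
              simp
          _ ≤ s + B * y := by
              have : (S.image (fun i => f i j)).card ≤ s :=
                Finset.card_image_le.trans (by omega)
              have : ((S.image (fun i => f i j)).card : ℝ) ≤ s := by exact_mod_cast this
              linarith
      refine (Finset.prod_le_prod (fun j _ => Finset.sum_nonneg fun b _ => ?_) h4).trans ?_
      · split_ifs <;> linarith
      · simp
    have h5 := sum_update_avg a (fun f : Fin N → Fin d → Fin B =>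
      ∏ j, y ^ ((insert a S).image (fun i => f i j)).card)
    have h6 := Finset.sum_le_sum (fun f (_ : f ∈ (Finset.univ : Finset (Fin N → Fin d → Fin B))) => key f)
    rw [h5, ← Finset.sum_mul] at h6
    have hc : (Fintype.card (Fin d → Fin B) : ℝ) = (B : ℝ) ^ d := by simp
    rw [hc] at h6
    have hBd : (0 : ℝ) < (B : ℝ) ^ d := by positivity
    have h7 : ((s : ℝ) + B * y) ^ d = (B : ℝ) ^ d * ((s : ℝ) / B + y) ^ d := by
      rw [← mul_pow]
      congr 1
      field_simp
    have hz : 0 ≤ ((s : ℝ) / B + y) ^ d := by positivity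
    have h8 := mul_le_mul_of_nonneg_right ih hz
    refine le_of_mul_le_mul_left ?_ hBd
    refine h6.trans ?_
    rw [h7, mul_add, mul_one, pow_add]
    nlinarith [mul_le_mul_of_nonneg_left h8 hBd.le]

open Classical in
/-- Tail bound for neighbourhood shrinkage under one-layer hashing: for a fixed set `S`
of size `s`, the probability (over a uniformly random `f : [N] → [B]^d`, stated by
counting instances) that `|Γ(S)| < (1−ε)ds` is at most `(e·s/(εB))^{εsd}`. -/
theorem neighbourhood_shrinkage_tail
    (N B d s : ℕ) (ε : ℝ) (hε : 0 < ε) (hε1 : ε < 1)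
    (hB : 0 < B) (hd : 0 < d)
    (hsN : s ≤ N) (hsB : (s : ℝ) < ε * B)
    (S : Finset (Fin N)) (hS : S.card = s) :
    ((Finset.univ.filter (fun f : Fin N → Fin d → Fin B =>
          ((nbrSet (oneLayerNbr f) S).card : ℝ) < (1 - ε) * d * s)).card : ℝ)
        / (Fintype.card (Fin N → Fin d → Fin B))
      ≤ (Real.exp 1 * s / (ε * B)) ^ (ε * s * d) := by
  have hB' : (0 : ℝ) < B := by exact_mod_cast hB
  rcases Nat.eq_zero_or_pos s with rfl | hs
  · simp [not_lt_of_ge]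
  have hs' : (0 : ℝ) < s := by exact_mod_cast hs
  have : Nonempty (Fin B) := ⟨⟨0, hB⟩⟩
  have hC : (0 : ℝ) < Fintype.card (Fin N → Fin d → Fin B) := by
    exact_mod_cast Fintype.card_pos
  obtain ⟨y, hy⟩ : ∃ y : ℝ, y = s / (ε * B) := ⟨_, rfl⟩
  have hy0 : 0 < y := by rw [hy]; positivity
  have hy1 : y ≤ 1 := by
    rw [hy, div_le_one (by positivity)]; exact hsB.le
  have hm := mgf_bound (d := d) hB y hy0.le S hS.le
  rw [hS] at hm
  have hsy : (s : ℝ) / B + y = y * (1 + ε) := by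
    rw [hy]; field_simp; ring
  have hexp : ((s : ℝ) / B + y) ^ (d * s) ≤ y ^ ((d : ℝ) * s) * Real.exp (ε * s * d) := by
    rw [hsy, mul_pow]
    have e1 : y ^ ((d : ℝ) * s) = y ^ (d * s) := by
      rw [← Real.rpow_natCast]; push_cast; rfl
    have e2 : Real.exp (ε * s * d) = (Real.exp ε) ^ (d * s) := by
      rw [← Real.exp_nat_mul]; push_cast; ring_nf
    rw [e1, e2]
    gcongr
    linarith [Real.add_one_le_exp ε]
  set A := Finset.univ.filter (fun f : Fin N → Fin d → Fin B =>
          ((nbrSet (oneLayerNbr f) S).card : ℝ) < (1 - ε) * d * s) with hA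
  have hmk : (A.card : ℝ) * y ^ ((1 - ε) * d * s)
      ≤ ∑ f : Fin N → Fin d → Fin B, ∏ j, y ^ (S.image (fun i => f i j)).card := by
    calc (A.card : ℝ) * y ^ ((1 - ε) * d * s) = ∑ f ∈ A, y ^ ((1 - ε) * d * s) := by simp
      _ ≤ ∑ f ∈ A, ∏ j, y ^ (S.image (fun i => f i j)).card := by
        refine Finset.sum_le_sum fun f hf => ?_
        rw [Finset.prod_pow_eq_pow_sum, ← nbr_card, ← Real.rpow_natCast]
        exact Real.rpow_le_rpow_of_exponent_ge hy0 hy1 (Finset.mem_filter.1 hf).2.le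
      _ ≤ _ := Finset.sum_le_sum_of_subset_of_nonneg (Finset.subset_univ _)
        (fun _ _ _ => Finset.prod_nonneg fun _ _ => pow_nonneg hy0.le _)
  have hr : (Real.exp 1 * s / (ε * B)) ^ (ε * s * d)
      = y ^ (ε * s * d) * Real.exp (ε * s * d) := by
    rw [mul_div_assoc, ← hy, Real.mul_rpow (Real.exp_pos 1).le hy0.le, Real.exp_one_rpow, mul_comm]
  have hsplit : y ^ ((d : ℝ) * s) = y ^ (ε * s * d) * y ^ ((1 - ε) * d * s) := by
    rw [← Real.rpow_add hy0]; congr 1; ring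
  rw [hr, div_le_iff₀ hC]
  have hp : 0 < y ^ ((1 - ε) * d * s) := Real.rpow_pos_of_pos hy0 _
  refine le_of_mul_le_mul_right ?_ hp
  refine (hmk.trans hm).trans ((mul_le_mul_of_nonneg_left hexp hC.le).trans (le_of_eq ?_))
  rw [hsplit]; ring
end

section
/- Per-set failure bound for two-layer hashing: There exist constants C, c > 0 such that for every ε ∈ (0,1/4), every integer k ≥ 1, every N ≥ C·max{k/ε², k²}, and all parameters with B₁ ≥ C·k/ε², d₁ ≥ C·(1/ε)·log(N/k)/log(B₁/k), B₂ ≥ C·k/ε and d₂ ≥ C·log(B₁/k), the following holds: for every fixed set S ⊆ [N] with |S| = s and 2 ≤ s ≤ 4k, the probability that the neighbourhood Γ(S) of S in the bipartite graph induced by a random (N,B₁,d₁,B₂,d₂) two-layer hashing scheme satisfies |Γ(S)| < (1−ε)·d₁·d₂·s is at most exp(−c·s·log(N/k)). -/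
/-- The `(d₁d₂)`-left-regular bipartite graph induced by an instance `(g, h)` of the
`(N,B₁,d₁,B₂,d₂)` two-layer hashing scheme: `x` is mapped to `(h_{i,j}(g_i(x)), i, j)`. -/
def twoLayerNbr {N B₁ d₁ B₂ d₂ : ℕ}
    (gh : (Fin N → Fin d₁ → Fin B₁) × (Fin d₁ → Fin d₂ → Fin B₁ → Fin B₂)) :
    Fin N → Fin d₁ × Fin d₂ → Fin B₂ × Fin d₁ × Fin d₂ :=
  fun x p => (gh.2 p.1 p.2 (gh.1 x p.1), p.1, p.2)

open Classical in
/-- Number of collisions of `f` on `T`. -/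
noncomputable def hashLoss {α β : Type*} (T : Finset α) (f : α → β) : ℕ :=
  T.card - (T.image f).card

open Classical in
theorem sum_update_eq {α β : Type*} [Fintype α] [Fintype β] (a : α) (F : (α → β) → ℝ) :
    ∑ f : α → β, ∑ b : β, F (Function.update f a b) = (Fintype.card β : ℝ) * ∑ f, F f := by
  have h1 : ∑ p : (α → β) × β, F (Function.update p.1 a p.2) = ∑ p : (α → β) × β, F p.1 := by
    have hinv : Function.Involutive
        (fun p : (α → β) × β => ((Function.update p.1 a p.2, p.1 a) : (α → β) × β)) := by
      intro p
      simp
    exact Equiv.sum_comp (hinv.toPerm) (fun p : (α → β) × β => F p.1)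
  rw [Fintype.sum_prod_type, Fintype.sum_prod_type] at h1
  rw [h1]
  simp [Finset.mul_sum]

open Classical in
theorem loss_update {α β : Type*} {T : Finset α} {a : α} (ha : a ∉ T) (f : α → β) (b : β) :
    hashLoss (insert a T) (Function.update f a b) =
      hashLoss T f + if b ∈ T.image f then 1 else 0 := by
  have him : (insert a T).image (Function.update f a b) = insert b (T.image f) := by
    rw [Finset.image_insert, Function.update_self]
    congr 1
    apply Finset.image_congr
    intro x hx
    have : x ≠ a := fun h => ha (h ▸ hx)
    simp [this]
  have hle : (T.image f).card ≤ T.card := Finset.card_image_le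
  unfold hashLoss
  rw [him, Finset.card_insert_of_notMem ha]
  by_cases hb : b ∈ T.image f
  · rw [Finset.insert_eq_of_mem hb, if_pos hb]; omega
  · rw [Finset.card_insert_of_notMem hb, if_neg hb]; omega

open Classical in
theorem loss_moment {α β : Type*} [Fintype α] [Fintype β] [Nonempty β] (l : ℝ) (hl : 0 ≤ l)
    (t : ℕ) (T : Finset α) (hT : T.card ≤ t) :
    ∑ f : α → β, l ^ hashLoss T f ≤
      (Fintype.card (α → β) : ℝ) * (1 + l * t / Fintype.card β) ^ T.card := by
  have hB : (0 : ℝ) < Fintype.card β := by exact_mod_cast Fintype.card_pos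
  induction T using Finset.induction_on with
  | empty => simp [hashLoss]
  | insert a T ha ih =>
    rw [Finset.card_insert_of_notMem ha] at hT ⊢
    have ih' := ih (by omega)
    have hu := sum_update_eq (β := β) a (fun f => l ^ hashLoss (insert a T) f)
    have hin : ∀ f : α → β, ∑ b : β, l ^ hashLoss (insert a T) (Function.update f a b) ≤
        l ^ hashLoss T f * (Fintype.card β * (1 + l * t / Fintype.card β)) := by
      intro f
      have hstep : ∀ b : β, l ^ hashLoss (insert a T) (Function.update f a b) ≤
          l ^ hashLoss T f * (1 + if b ∈ T.image f then l else 0) := by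
        intro b
        rw [loss_update ha, pow_add]
        apply mul_le_mul_of_nonneg_left _ (pow_nonneg hl _)
        split_ifs <;> simp
      refine (Finset.sum_le_sum fun b _ => hstep b).trans ?_
      rw [← Finset.mul_sum]
      apply mul_le_mul_of_nonneg_left _ (pow_nonneg hl _)
      rw [Finset.sum_add_distrib, ← Finset.sum_filter]
      simp only [Finset.sum_const, nsmul_eq_mul, Finset.card_univ, mul_one]
      have h2 : (Finset.univ.filter (fun b => b ∈ T.image f)) = T.image f := by
        ext b; simp
      rw [h2]
      have h3 : ((T.image f).card : ℝ) ≤ t := by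
        exact_mod_cast (Finset.card_image_le (s := T) (f := f)).trans (by omega)
      have h4 : (Fintype.card β : ℝ) * (1 + l * t / Fintype.card β) = Fintype.card β + t * l := by
        field_simp
      rw [h4]
      have := mul_le_mul_of_nonneg_right h3 hl
      linarith
    have hs := Finset.sum_le_sum (s := Finset.univ) fun f _ => hin f
    rw [hu, ← Finset.sum_mul] at hs
    have hq : 0 ≤ 1 + l * t / (Fintype.card β : ℝ) := by positivity
    have h5 : ∑ f : α → β, l ^ hashLoss (insert a T) f ≤
        (∑ f : α → β, l ^ hashLoss T f) * (1 + l * t / Fintype.card β) := by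
      refine le_of_mul_le_mul_left ?_ hB
      calc _ ≤ _ := hs
        _ = _ := by ring
    refine h5.trans ((mul_le_mul_of_nonneg_right ih' hq).trans (le_of_eq ?_))
    ring

theorem loss_moment_exp {α β : Type*} [Fintype α] [Fintype β] [Nonempty β] (l : ℝ) (hl : 0 ≤ l)
    (t : ℕ) (T : Finset α) (hT : T.card ≤ t) [DecidableEq α] :
    ∑ f : α → β, l ^ hashLoss T f ≤
      (Fintype.card (α → β) : ℝ) * Real.exp (l * t * t / Fintype.card β) := by
  have h : ∑ f : α → β, l ^ hashLoss T f ≤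
      (Fintype.card (α → β) : ℝ) * (1 + l * t / Fintype.card β) ^ T.card := by
    convert loss_moment (β := β) l hl t T hT
  have hx : 0 ≤ l * t / (Fintype.card β : ℝ) := by positivity
  have e1 : (1 + l * t / (Fintype.card β : ℝ)) ^ T.card ≤
      Real.exp (l * t * t / Fintype.card β) := by
    calc (1 + l * t / (Fintype.card β : ℝ)) ^ T.card
        ≤ (1 + l * t / (Fintype.card β : ℝ)) ^ t := pow_le_pow_right₀ (by linarith) hT
      _ ≤ (Real.exp (l * t / (Fintype.card β : ℝ))) ^ t := by
          apply pow_le_pow_left₀ (by linarith)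
          have := Real.add_one_le_exp (l * t / (Fintype.card β : ℝ))
          linarith
      _ = _ := by
          rw [← Real.exp_nat_mul]; congr 1; ring
  refine le_trans h (mul_le_mul_of_nonneg_left e1 (by positivity))

/-- Independence over a family. -/
theorem family_moment {ι X : Type*} [DecidableEq ι] [Fintype ι] [Fintype X] (w : ι → X → ℝ)
    (hw : ∀ i x, 0 ≤ w i x) (M : ℝ) (h : ∀ i, ∑ x, w i x ≤ M) :
    ∑ f : ι → X, ∏ i, w i (f i) ≤ M ^ Fintype.card ι := by
  have := Finset.prod_univ_sum (fun _ : ι => (Finset.univ : Finset X)) w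
  rw [Fintype.piFinset_univ] at this
  rw [← this]
  calc ∏ i, ∑ x, w i x ≤ ∏ _i : ι, M :=
        Finset.prod_le_prod (fun i _ => Finset.sum_nonneg fun x _ => hw i x) (fun i _ => h i)
    _ = _ := by simp

open Classical in
theorem first_moment {N d₁ B₁ : ℕ} (hB : 0 < B₁) (l : ℝ) (hl : 0 ≤ l) (S : Finset (Fin N)) :
    ∑ g : Fin N → Fin d₁ → Fin B₁, l ^ (∑ i, hashLoss S (fun x => g x i)) ≤
      (Fintype.card (Fin N → Fin d₁ → Fin B₁) : ℝ) *
        Real.exp (l * S.card * S.card / B₁ * d₁) := by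
  have : Nonempty (Fin B₁) := ⟨⟨0, hB⟩⟩
  have h1 := family_moment (ι := Fin d₁) (X := Fin N → Fin B₁)
    (fun _ f => l ^ hashLoss S f) (fun _ _ => pow_nonneg hl _) _
    (fun _ => loss_moment_exp l hl S.card S le_rfl)
  have h2 : ∑ g : Fin N → Fin d₁ → Fin B₁, l ^ (∑ i, hashLoss S (fun x => g x i)) =
      ∑ f : Fin d₁ → Fin N → Fin B₁, ∏ i, l ^ hashLoss S (f i) := by
    rw [← (Equiv.piComm (fun (_ : Fin N) (_ : Fin d₁) => Fin B₁)).sum_comp]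
    apply Finset.sum_congr rfl
    intro g _
    rw [Finset.prod_pow_eq_pow_sum]
    rfl
  rw [h2]
  refine h1.trans (le_of_eq ?_)
  rw [mul_pow, ← Real.exp_nat_mul]
  simp only [Fintype.card_fin, Fintype.card_pi, Finset.prod_const, Finset.card_univ]
  push_cast
  rw [← pow_mul, ← pow_mul, mul_comm N d₁]
  congr 2
  ring

open Classical in
theorem second_moment {d₁ d₂ B₁ B₂ : ℕ} (hB : 0 < B₂) (l : ℝ) (hl : 0 ≤ l) (s : ℕ)
    (T : Fin d₁ → Finset (Fin B₁)) (hT : ∀ i, (T i).card ≤ s) :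
    ∑ h : Fin d₁ → Fin d₂ → Fin B₁ → Fin B₂, l ^ (∑ i, ∑ j, hashLoss (T i) (h i j)) ≤
      (Fintype.card (Fin d₁ → Fin d₂ → Fin B₁ → Fin B₂) : ℝ) *
        Real.exp (l * s * s / B₂ * (d₁ * d₂)) := by
  have : Nonempty (Fin B₂) := ⟨⟨0, hB⟩⟩
  have h0 := fun i => family_moment (ι := Fin d₂) (X := Fin B₁ → Fin B₂)
    (fun _ f => l ^ hashLoss (T i) f) (fun _ _ => pow_nonneg hl _) _
    (fun _ => loss_moment_exp l hl s (T i) (hT i))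
  have h1 := family_moment (ι := Fin d₁) (X := Fin d₂ → Fin B₁ → Fin B₂)
    (fun i f => ∏ j, l ^ hashLoss (T i) (f j))
    (fun _ _ => Finset.prod_nonneg fun _ _ => pow_nonneg hl _) _ h0
  simp only [Finset.prod_pow_eq_pow_sum] at h1
  refine h1.trans (le_of_eq ?_)
  rw [mul_pow, mul_pow, ← Real.exp_nat_mul, ← Real.exp_nat_mul]
  simp only [Fintype.card_fin, Fintype.card_pi, Finset.prod_const, Finset.card_univ]
  push_cast
  congr 2
  ring

open Classical in
theorem card_nbr_ge {N B₁ d₁ B₂ d₂ : ℕ}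
    (gh : (Fin N → Fin d₁ → Fin B₁) × (Fin d₁ → Fin d₂ → Fin B₁ → Fin B₂))
    (S : Finset (Fin N)) :
    d₁ * d₂ * S.card ≤ (nbrSet (twoLayerNbr gh) S).card
      + d₂ * (∑ i, hashLoss S (fun x => gh.1 x i))
      + ∑ i, ∑ j, hashLoss (S.image (fun x => gh.1 x i)) (gh.2 i j) := by
  have h1 : ∑ p : Fin d₁ × Fin d₂,
      ((S.image (fun x => gh.1 x p.1)).image (gh.2 p.1 p.2)).card ≤
      (nbrSet (twoLayerNbr gh) S).card := by
    rw [Finset.card_eq_sum_card_fiberwise (f := Prod.snd) (t := Finset.univ)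
      (fun _ _ => Finset.mem_coe.2 (Finset.mem_univ _))]
    apply Finset.sum_le_sum
    intro p _
    apply Finset.card_le_card_of_injOn (fun b => (b, p))
    · intro b hb
      simp only [Finset.coe_image, Set.mem_image, Finset.mem_coe] at hb
      obtain ⟨y, ⟨x, hx, rfl⟩, rfl⟩ := hb
      simp only [Finset.coe_filter, Set.mem_ofPred_eq, and_true, nbrSet, Finset.mem_biUnion,
        Finset.mem_image, Finset.mem_univ, true_and]
      exact ⟨x, hx, p, rfl⟩
    · intro b _ b' _ hbb
      exact (Prod.ext_iff.1 hbb).1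
  rw [Fintype.sum_prod_type] at h1
  have h2 : ∀ i j, S.card ≤ ((S.image (fun x => gh.1 x i)).image (gh.2 i j)).card
      + hashLoss S (fun x => gh.1 x i)
      + hashLoss (S.image (fun x => gh.1 x i)) (gh.2 i j) := by
    intro i j
    have a1 : (S.image (fun x => gh.1 x i)).card ≤ S.card := Finset.card_image_le
    have a2 : ((S.image (fun x => gh.1 x i)).image (gh.2 i j)).card ≤
      (S.image (fun x => gh.1 x i)).card := Finset.card_image_le
    unfold hashLoss
    have e1 : (Finset.image (fun x => gh.1 x i) S).card ≤ S.card := a1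
    convert (show S.card ≤ ((S.image (fun x => gh.1 x i)).image (gh.2 i j)).card
      + (S.card - (S.image (fun x => gh.1 x i)).card)
      + ((S.image (fun x => gh.1 x i)).card
        - ((S.image (fun x => gh.1 x i)).image (gh.2 i j)).card) by omega)
  have h3 := Finset.sum_le_sum (s := (Finset.univ : Finset (Fin d₁))) fun i _ =>
    Finset.sum_le_sum (s := (Finset.univ : Finset (Fin d₂))) fun j _ => h2 i j
  simp only [Finset.sum_add_distrib, Finset.sum_const, Finset.card_univ, Fintype.card_fin,
    smul_eq_mul, ← Finset.mul_sum] at h3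
  simp only [] at h1
  rw [mul_assoc]
  omega

theorem markov_one (l a : ℝ) (n : ℕ) (hl : 0 ≤ l) (h : a ≤ n) :
    1 ≤ (Real.exp l) ^ n * Real.exp (-(l * a)) := by
  rw [← Real.exp_nat_mul, ← Real.exp_add]
  apply Real.one_le_exp
  nlinarith

open Classical in
theorem prob_bound {N B₁ d₁ B₂ d₂ : ℕ} (hB₁ : 0 < B₁) (hB₂ : 0 < B₂) (ε : ℝ)
    (S : Finset (Fin N)) (l m : ℝ) (hl : 0 ≤ l) (hm : 0 ≤ m) :
    ((Finset.univ.filter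
      (fun gh : (Fin N → Fin d₁ → Fin B₁) × (Fin d₁ → Fin d₂ → Fin B₁ → Fin B₂) =>
        ((nbrSet (twoLayerNbr gh) S).card : ℝ) < (1 - ε) * (d₁ * d₂) * S.card)).card : ℝ)
     ≤ (Fintype.card ((Fin N → Fin d₁ → Fin B₁) × (Fin d₁ → Fin d₂ → Fin B₁ → Fin B₂)) : ℝ) *
      (Real.exp (Real.exp l * S.card * S.card / B₁ * d₁) * Real.exp (-(l * (ε / 2 * d₁ * S.card)))
      + Real.exp (Real.exp m * S.card * S.card / B₂ * (d₁ * d₂)) *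
          Real.exp (-(m * (ε / 2 * (d₁ * d₂) * S.card)))) := by
  set e₁ := Real.exp (-(l * (ε / 2 * d₁ * S.card))) with he₁
  set e₂ := Real.exp (-(m * (ε / 2 * (d₁ * d₂) * S.card))) with he₂
  have p₁ : 0 ≤ e₁ := (Real.exp_pos _).le
  have p₂ : 0 ≤ e₂ := (Real.exp_pos _).le
  have hpt : ∀ gh : (Fin N → Fin d₁ → Fin B₁) × (Fin d₁ → Fin d₂ → Fin B₁ → Fin B₂),
      (if ((nbrSet (twoLayerNbr gh) S).card : ℝ) < (1 - ε) * (d₁ * d₂) * S.card then (1:ℝ) else 0)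
      ≤ Real.exp l ^ (∑ i, hashLoss S (fun x => gh.1 x i)) * e₁ +
        Real.exp m ^ (∑ i, ∑ j, hashLoss (S.image (fun x => gh.1 x i)) (gh.2 i j)) * e₂ := by
    intro gh
    have q₁ : 0 ≤ Real.exp l ^ (∑ i, hashLoss S (fun x => gh.1 x i)) * e₁ := by positivity
    have q₂ : 0 ≤ Real.exp m ^ (∑ i, ∑ j, hashLoss (S.image (fun x => gh.1 x i)) (gh.2 i j)) * e₂ :=
      by positivity
    split_ifs with hbad
    · have hc : ((d₁ * d₂ * S.card : ℕ) : ℝ) ≤ _ := Nat.cast_le.2 (card_nbr_ge gh S)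
      push_cast only [Nat.cast_add, Nat.cast_mul] at hc
      by_cases hA : ε / 2 * d₁ * S.card ≤ ((∑ i, hashLoss S (fun x => gh.1 x i) : ℕ) : ℝ)
      · have := markov_one l _ _ hl hA
        linarith
      · have hA' := (not_le.1 hA).le
        have hd : (0:ℝ) ≤ d₂ := Nat.cast_nonneg _
        have h6 := mul_le_mul_of_nonneg_left hA' hd
        have hB : ε / 2 * (d₁ * d₂) * S.card ≤
          ((∑ i, ∑ j, hashLoss (S.image (fun x => gh.1 x i)) (gh.2 i j) : ℕ) : ℝ) := by
          nlinarith
        have := markov_one m _ _ hm hB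
        linarith
    · linarith
  rw [Finset.card_filter]
  push_cast
  refine (Finset.sum_le_sum fun gh _ => hpt gh).trans ?_
  rw [Finset.sum_add_distrib, ← Finset.sum_mul, ← Finset.sum_mul, Fintype.sum_prod_type,
    Fintype.sum_prod_type, mul_add, ← mul_assoc, ← mul_assoc]
  simp only []
  apply add_le_add
  · apply mul_le_mul_of_nonneg_right _ p₁
    simp only [Finset.sum_const, Finset.card_univ, nsmul_eq_mul, ← Finset.mul_sum]
    rw [Fintype.card_prod, Nat.cast_mul]
    have := mul_le_mul_of_nonneg_left (first_moment (d₁ := d₁) hB₁ (Real.exp l) (Real.exp_pos _).le S)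
      (Nat.cast_nonneg (α := ℝ) (Fintype.card (Fin d₁ → Fin d₂ → Fin B₁ → Fin B₂)))
    refine this.trans (le_of_eq ?_)
    ring
  · apply mul_le_mul_of_nonneg_right _ p₂
    refine (Finset.sum_le_sum fun g _ => second_moment (d₁ := d₁) (d₂ := d₂) hB₂ (Real.exp m)
      (Real.exp_pos _).le S.card (fun i => S.image (fun x => g x i))
      (fun i => Finset.card_image_le)).trans (le_of_eq ?_)
    rw [Finset.sum_const, Finset.card_univ, nsmul_eq_mul, Fintype.card_prod, Nat.cast_mul]
    ring

theorem log_ge_two {x : ℝ} (hx : 4096 ≤ x) : 2 ≤ Real.log x := by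
  rw [Real.le_log_iff_exp_le (by linarith)]
  have h := Real.exp_one_lt_d9
  have : Real.exp 2 = Real.exp 1 * Real.exp 1 := by rw [← Real.exp_add]; norm_num
  have h0 := Real.exp_pos 1
  rw [this]; nlinarith

theorem layer_one_num {ε k B d s L R : ℝ} (hε : 0 < ε) (hk : 0 < k) (hB : 256 * k / ε ^ 2 ≤ B)
    (hs0 : 0 ≤ s) (hs : s ≤ 4 * k) (hd0 : 0 ≤ d) (hL : L = Real.log (B / k)) (hL2 : 2 ≤ L)
    (hd : 256 * (1 / ε) * R / L ≤ d) :
    Real.exp (L / 2) * s * s / B * d + -(L / 2 * (ε / 2 * d * s)) ≤ -(32 * s * R) := by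
  have hBpos : 0 < B := lt_of_lt_of_le (by positivity) hB
  have hq : Real.exp (L / 2) * Real.exp (L / 2) = B / k := by
    rw [← Real.exp_add, add_halves, hL, Real.exp_log (by positivity)]
  set q := Real.exp (L / 2) with hqd
  have hq0 : 0 < q := Real.exp_pos _
  have hBq : B = k * (q * q) := by rw [hq]; field_simp
  have hqe : 16 ≤ q * ε := by
    rw [div_le_iff₀ (by positivity), hBq] at hB
    have h1 : 256 ≤ (q * ε) ^ 2 := by
      have : k * 256 ≤ k * (q * ε) ^ 2 := by linarith [hB]
      exact le_of_mul_le_mul_left this hk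
    nlinarith [mul_pos hq0 hε]
  have h1 : q * s * s / B * d ≤ ε / 4 * d * s := by
    have : q * s / B ≤ ε / 4 := by
      rw [div_le_iff₀ hBpos, hBq]
      have : q * s ≤ q * (4 * k) := mul_le_mul_of_nonneg_left hs hq0.le
      have h2 : (q * k) * 16 ≤ (q * k) * (q * ε) :=
        mul_le_mul_of_nonneg_left hqe (by positivity)
      linarith
    calc q * s * s / B * d = (q * s / B) * (d * s) := by ring
      _ ≤ ε / 4 * (d * s) := mul_le_mul_of_nonneg_right this (by positivity)
      _ = _ := by ring
  have h2 : 256 * R ≤ ε * d * L := by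
    rw [div_le_iff₀ (by linarith)] at hd
    have := mul_le_mul_of_nonneg_left hd hε.le
    calc 256 * R = ε * (256 * (1 / ε) * R) := by field_simp
      _ ≤ _ := this
      _ = _ := by ring
  have h3 : s * (256 * R) ≤ s * (ε * d * L) := mul_le_mul_of_nonneg_left h2 hs0
  have h4 : (ε * d * s) * 2 ≤ (ε * d * s) * L := mul_le_mul_of_nonneg_left hL2 (by positivity)
  nlinarith

theorem layer_two_num {ε k B d₁ d₂ s L R : ℝ} (hε : 0 < ε) (hk : 0 < k)
    (hB : 256 * k / ε ≤ B) (hs0 : 0 ≤ s) (hs : s ≤ 4 * k) (hd0 : 0 ≤ d₁)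
    (hL2 : 2 ≤ L) (hR : 0 ≤ R)
    (hd : 256 * (1 / ε) * R / L ≤ d₁) (hd₂ : 256 * L ≤ d₂) :
    Real.exp 1 * s * s / B * (d₁ * d₂) + -(1 * (ε / 2 * (d₁ * d₂) * s)) ≤ -(32 * s * R) := by
  have hBpos : 0 < B := lt_of_lt_of_le (by positivity) hB
  have hd20 : 0 ≤ d₂ := by linarith
  have h2 : 256 * R ≤ ε * d₁ * L := by
    rw [div_le_iff₀ (by linarith)] at hd
    have := mul_le_mul_of_nonneg_left hd hε.le
    calc 256 * R = ε * (256 * (1 / ε) * R) := by field_simp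
      _ ≤ _ := this
      _ = _ := by ring
  have h3 : 256 * (256 * R) ≤ ε * d₁ * d₂ := by
    have := mul_le_mul_of_nonneg_left hd₂ (show 0 ≤ ε * d₁ by positivity)
    linarith
  have h1 : Real.exp 1 * s * s / B * (d₁ * d₂) ≤ ε / 4 * (d₁ * d₂ * s) := by
    have : Real.exp 1 * s / B ≤ ε / 4 := by
      rw [div_le_iff₀ hBpos]
      rw [div_le_iff₀ hε] at hB
      have he := Real.exp_one_lt_d9
      have : Real.exp 1 * s ≤ 3 * s := mul_le_mul_of_nonneg_right (by linarith) hs0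
      linarith
    calc Real.exp 1 * s * s / B * (d₁ * d₂) = (Real.exp 1 * s / B) * (d₁ * d₂ * s) := by ring
      _ ≤ _ := mul_le_mul_of_nonneg_right this (by positivity)
  have h4 : s * (256 * (256 * R)) ≤ s * (ε * d₁ * d₂) := mul_le_mul_of_nonneg_left h3 hs0
  have h5 : 0 ≤ s * R := by positivity
  nlinarith

open Classical in
/-- Per-set failure bound for two-layer hashing: for a fixed set `S` with
`2 ≤ |S| = s ≤ 4k`, the probability (stated by counting instances of the two-layer
hashing scheme) that `|Γ(S)| < (1−ε)d₁d₂s` is at most `exp(−c·s·log(N/k))`. -/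
theorem two_layer_per_set_failure :
    ∃ C c : ℝ, 0 < C ∧ 0 < c ∧
      ∀ ε : ℝ, 0 < ε → ε < 1/4 →
      ∀ k : ℕ, 1 ≤ k →
      ∀ N : ℕ, (N : ℝ) ≥ C * max ((k : ℝ) / ε^2) ((k : ℝ)^2) →
      ∀ B₁ d₁ B₂ d₂ : ℕ,
        (B₁ : ℝ) ≥ C * k / ε^2 →
        (d₁ : ℝ) ≥ C * (1/ε) * Real.log ((N : ℝ) / k) / Real.log ((B₁ : ℝ) / k) →
        (B₂ : ℝ) ≥ C * k / ε →
        (d₂ : ℝ) ≥ C * Real.log ((B₁ : ℝ) / k) →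
      ∀ s : ℕ, 2 ≤ s → s ≤ 4 * k →
      ∀ S : Finset (Fin N), S.card = s →
        ((Finset.univ.filter
            (fun gh : (Fin N → Fin d₁ → Fin B₁) × (Fin d₁ → Fin d₂ → Fin B₁ → Fin B₂) =>
              ((nbrSet (twoLayerNbr gh) S).card : ℝ) < (1 - ε) * (d₁ * d₂) * s)).card : ℝ)
          / (Fintype.card ((Fin N → Fin d₁ → Fin B₁) × (Fin d₁ → Fin d₂ → Fin B₁ → Fin B₂)))
          ≤ Real.exp (-(c * s * Real.log ((N : ℝ) / k))) := by
  refine ⟨256, 1, by norm_num, by norm_num, ?_⟩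
  intro ε hε hε4 k hk N hN B₁ d₁ B₂ d₂ hB₁ hd₁ hB₂ hd₂ s hs2 hs4 S hS
  have hkR : (0:ℝ) < k := by exact_mod_cast hk
  have hε2 : ε ^ 2 ≤ 1 / 16 := by nlinarith
  have hεsq : 0 < ε ^ 2 := by positivity
  have hbig : ∀ x : ℝ, 256 * k / ε ^ 2 ≤ x → 2 ≤ Real.log (x / k) := by
    intro x hx
    apply log_ge_two
    rw [le_div_iff₀ hkR]
    have hx0 : 0 < x := lt_of_lt_of_le (by positivity) hx
    rw [div_le_iff₀ hεsq] at hx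
    nlinarith
  have hL2 := hbig B₁ hB₁
  have hR2 : 2 ≤ Real.log ((N : ℝ) / k) := by
    apply hbig
    have := le_max_left ((k : ℝ) / ε^2) ((k : ℝ)^2)
    rw [mul_div_assoc]
    linarith
  have hB₁p : 0 < B₁ := by
    have : (0:ℝ) < B₁ := lt_of_lt_of_le (by positivity) hB₁
    exact_mod_cast this
  have hB₂p : 0 < B₂ := by
    have : (0:ℝ) < B₂ := lt_of_lt_of_le (by positivity) hB₂
    exact_mod_cast this
  have hs4R : (s : ℝ) ≤ 4 * k := by exact_mod_cast hs4
  have hs2R : (2:ℝ) ≤ s := by exact_mod_cast hs2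
  have n1 := layer_one_num hε hkR hB₁ (Nat.cast_nonneg s) hs4R (Nat.cast_nonneg d₁) rfl hL2 hd₁
  have n2 := layer_two_num hε hkR hB₂ (Nat.cast_nonneg s) hs4R (Nat.cast_nonneg d₁) hL2
    (by linarith) hd₁ hd₂
  have hp := prob_bound (d₁ := d₁) (d₂ := d₂) hB₁p hB₂p ε S (Real.log ((B₁ : ℝ) / k) / 2) 1
    (by linarith) (by norm_num)
  rw [hS, ← Real.exp_add, ← Real.exp_add] at hp
  have : Nonempty (Fin B₁) := ⟨⟨0, hB₁p⟩⟩
  have : Nonempty (Fin B₂) := ⟨⟨0, hB₂p⟩⟩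
  have hcard : (0:ℝ) < Fintype.card
      ((Fin N → Fin d₁ → Fin B₁) × (Fin d₁ → Fin d₂ → Fin B₁ → Fin B₂)) := by
    exact_mod_cast Fintype.card_pos
  rw [div_le_iff₀' hcard]
  refine hp.trans (mul_le_mul_of_nonneg_left ?_ hcard.le)
  have m1 := Real.exp_le_exp.2 n1
  have m2 := Real.exp_le_exp.2 n2
  refine (add_le_add m1 m2).trans ?_
  set R := Real.log ((N : ℝ) / k) with hRdef
  have hsR : 4 ≤ (s:ℝ) * R := by nlinarith
  have h31 : 2 ≤ Real.exp (31 * (s * R)) := by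
    have := Real.add_one_le_exp (31 * ((s:ℝ) * R))
    linarith
  have hsplit : Real.exp (-(1 * s * R)) = Real.exp (31 * (s * R)) * Real.exp (-(32 * s * R)) := by
    rw [← Real.exp_add]; congr 1; ring
  rw [hsplit]
  have := mul_le_mul_of_nonneg_right h31 (Real.exp_pos (-(32 * s * R))).le
  linarith
end
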